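/- arXiv:1011.1832 — 6 statements merged into one kernel-verified Lean document; each statement's English description precedes it below -/
import Mathlib

section
/- Let k ≥ 2, let μ be an atomless (non-atomic) probability measure on ℝ, and let ξ_1, …, ξ_k be i.i.d. with law μ. For t > 0 let N_t denote the number of indices i ∈ {1,…,k} such that no other sample point ξ_j (j ≠ i) lies in the half-open interval (ξ_i, ξ_i + t]. Then E[N_t(N_t − 1)] = 2 k(k−1) ∫_ℝ ∫_{(y+t, ∞)} (1 − μ((y, y+t]) − μ((z, z+t]))^{k−2} dμ(z) dμ(y). -/
open MeasureTheory ProbabilityTheory Filter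

lemma spc_card {k : ℕ} (p : Fin k → Prop) [DecidablePred p] :
    ((Finset.univ.filter p).card : ℝ) * (((Finset.univ.filter p).card : ℝ) - 1)
      = ∑ i, ∑ j, if i ≠ j then (if p i ∧ p j then (1:ℝ) else 0) else 0 := by
  have h1 : ((Finset.univ.filter p).card : ℝ) = ∑ i, if p i then (1:ℝ) else 0 := by
    simp
  have h2 : ((Finset.univ.filter p).card : ℝ)
      = ∑ i, ∑ j, if i = j then (if p i then (1:ℝ) else 0) else 0 := by
    simp
  rw [mul_sub, mul_one]
  nth_rw 3 [h2]
  rw [h1, Finset.sum_mul_sum, ← Finset.sum_sub_distrib]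
  refine Finset.sum_congr rfl fun i _ => ?_
  rw [← Finset.sum_sub_distrib]
  refine Finset.sum_congr rfl fun j _ => ?_
  by_cases hij : i = j
  · subst hij; by_cases h : p i <;> simp [h]
  · by_cases h : p i <;> by_cases h' : p j <;> simp [h, h', hij]

/-- The event that `ξ j > ξ i + t` and no other point is in either interval. -/
def spcB {Ω : Type*} {k : ℕ} (ξ : Fin k → Ω → ℝ) (t : ℝ) (i j : Fin k) : Set Ω :=
  {ω | ξ i ω + t < ξ j ω ∧ ∀ l, l ≠ i → l ≠ j →
    ξ l ω ∉ Set.Ioc (ξ i ω) (ξ i ω + t) ∪ Set.Ioc (ξ j ω) (ξ j ω + t)}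

lemma spc_iff {Ω : Type*} {k : ℕ} (ξ : Fin k → Ω → ℝ) (t : ℝ) (ht : 0 < t) (i j : Fin k)
    (hij : i ≠ j) (ω : Ω) (hne : ξ i ω ≠ ξ j ω) :
    ((∀ l, l ≠ i → ξ l ω ∉ Set.Ioc (ξ i ω) (ξ i ω + t)) ∧
      (∀ l, l ≠ j → ξ l ω ∉ Set.Ioc (ξ j ω) (ξ j ω + t))) ↔
      (ω ∈ spcB ξ t i j ∨ ω ∈ spcB ξ t j i) := by
  simp only [spcB, Set.mem_ofPred_eq, Set.mem_union, not_or]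
  constructor
  · rintro ⟨h1, h2⟩
    rcases lt_or_gt_of_ne hne with h | h
    · left
      refine ⟨?_, fun l hi hj => ⟨h1 l hi, h2 l hj⟩⟩
      by_contra hc
      exact h1 j hij.symm ⟨h, not_lt.1 hc⟩
    · right
      refine ⟨?_, fun l hj hi => ⟨h2 l hj, h1 l hi⟩⟩
      by_contra hc
      exact h2 i hij ⟨h, not_lt.1 hc⟩
  · rintro (⟨h, h1⟩ | ⟨h, h1⟩)
    · refine ⟨fun l hl => ?_, fun l hl => ?_⟩
      · by_cases e : l = j
        · subst e; exact fun hh => absurd hh.2 (not_le.2 h)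
        · exact (h1 l hl e).1
      · by_cases e : l = i
        · subst e; exact fun hh => by linarith [hh.1]
        · exact (h1 l e hl).2
    · refine ⟨fun l hl => ?_, fun l hl => ?_⟩
      · by_cases e : l = j
        · subst e; exact fun hh => by linarith [hh.1]
        · exact (h1 l e hl).2
      · by_cases e : l = i
        · subst e; exact fun hh => absurd hh.2 (not_le.2 h)
        · exact (h1 l hl e).1

lemma spc_meas {Ω : Type*} [MeasurableSpace Ω] {k : ℕ} (ξ : Fin k → Ω → ℝ)
    (hmeas : ∀ i, Measurable (ξ i)) (t : ℝ) (i j : Fin k) : MeasurableSet (spcB ξ t i j) := by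
  have hi := hmeas i
  have hj := hmeas j
  have e : spcB ξ t i j = {ω | ξ i ω + t < ξ j ω} ∩ ⋂ l, {ω | l ≠ i → l ≠ j →
      ¬ ((ξ i ω < ξ l ω ∧ ξ l ω ≤ ξ i ω + t) ∨ (ξ j ω < ξ l ω ∧ ξ l ω ≤ ξ j ω + t))} := by
    ext ω; simp [spcB]
  rw [e]
  refine (measurableSet_lt (by fun_prop) (by fun_prop)).inter (MeasurableSet.iInter fun l => ?_)
  have hl := hmeas l
  have key : ∀ f g : Ω → ℝ, Measurable f → Measurable g →
      Measurable (fun q => f q < g q) ∧ Measurable (fun q => f q ≤ g q) := fun f g hf hg =>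
    ⟨measurableSet_setOf.1 (measurableSet_lt hf hg), measurableSet_setOf.1 (measurableSet_le hf hg)⟩
  refine measurableSet_setOf.2 (Measurable.imp measurable_const (Measurable.imp measurable_const
    (Measurable.not (Measurable.or (Measurable.and ?_ ?_) (Measurable.and ?_ ?_)))))
  · exact (key _ _ (by fun_prop) (by fun_prop)).1
  · exact (key _ _ (by fun_prop) (by fun_prop)).2
  · exact (key _ _ (by fun_prop) (by fun_prop)).1
  · exact (key _ _ (by fun_prop) (by fun_prop)).2

lemma spc_prob {Ω : Type*} [MeasurableSpace Ω] (P : Measure Ω) [IsProbabilityMeasure P]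
    (k : ℕ) (μ : Measure ℝ) [IsProbabilityMeasure μ]
    (ξ : Fin k → Ω → ℝ) (hmeas : ∀ i, Measurable (ξ i))
    (hindep : iIndepFun ξ P)
    (hlaw : ∀ i, Measure.map (ξ i) P = μ)
    (t : ℝ) (ht : 0 < t) (i j : Fin k) (hij : i ≠ j) :
    P.real (spcB ξ t i j) = ∫ y, (∫ z in Set.Ioi (y + t),
          (1 - (μ (Set.Ioc y (y + t))).toReal - (μ (Set.Ioc z (z + t))).toReal) ^ (k - 2) ∂μ) ∂μ := by
  classical
  let S : Finset (Fin k) := {i, j}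
  let T : Finset (Fin k) := Sᶜ
  have hiS : i ∈ S := by simp [S]
  have hjS : j ∈ S := by simp [S]
  have hT : T.card = k - 2 := by
    rw [Finset.card_compl, Finset.card_pair hij, Fintype.card_fin]
  have hST : IndepFun (fun ω => (ξ i ω, ξ j ω)) (fun ω (l : T) => ξ l ω) P := by
    have h := hindep.indepFun_finset S T disjoint_compl_right hmeas
    exact h.comp (φ := fun v : S → ℝ => (v ⟨i, hiS⟩, v ⟨j, hjS⟩)) (ψ := id)
      (by fun_prop) measurable_id
  have hlawij : P.map (fun ω => (ξ i ω, ξ j ω)) = μ.prod μ := by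
    have h := (indepFun_iff_map_prod_eq_prod_map_map (hmeas i).aemeasurable
      (hmeas j).aemeasurable).1 (hindep.indepFun hij)
    rw [h, hlaw, hlaw]
  have hlawT : P.map (fun ω (l : T) => ξ l ω) = Measure.pi (fun _ : T => μ) := by
    have h0 : iIndepFun (fun l : T => ξ l) P := hindep.precomp Subtype.val_injective
    have h := (iIndepFun_iff_map_fun_eq_pi_map (fun l : T => (hmeas l).aemeasurable)).1 h0
    rw [h]; simp only [hlaw]
  have mp : Measurable (fun ω => (ξ i ω, ξ j ω)) := (hmeas i).prodMk (hmeas j)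
  have mT : Measurable (fun ω (l : T) => ξ l ω) := measurable_pi_lambda _ fun l => hmeas l
  have hlaw2 := (indepFun_iff_map_prod_eq_prod_map_map mp.aemeasurable mT.aemeasurable).1 hST
  rw [hlawij, hlawT] at hlaw2
  let C : Set ((ℝ × ℝ) × (T → ℝ)) := {q | q.1.1 + t < q.1.2 ∧
    ∀ l, ¬ ((q.1.1 < q.2 l ∧ q.2 l ≤ q.1.1 + t) ∨ (q.1.2 < q.2 l ∧ q.2 l ≤ q.1.2 + t))}
  have hC : MeasurableSet C := by
    have key : ∀ f g : (ℝ × ℝ) × (T → ℝ) → ℝ, Measurable f → Measurable g →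
        Measurable (fun q => f q < g q) ∧ Measurable (fun q => f q ≤ g q) := fun f g hf hg =>
      ⟨measurableSet_setOf.1 (measurableSet_lt hf hg), measurableSet_setOf.1 (measurableSet_le hf hg)⟩
    refine measurableSet_setOf.2 (Measurable.and ?_ (Measurable.forall fun l =>
      (Measurable.not (Measurable.or (Measurable.and ?_ ?_) (Measurable.and ?_ ?_)))))
    · exact (key _ _ (by fun_prop) (by fun_prop)).1
    · exact (key _ _ (by fun_prop) (by fun_prop)).1
    · exact (key _ _ (by fun_prop) (by fun_prop)).2
    · exact (key _ _ (by fun_prop) (by fun_prop)).1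
    · exact (key _ _ (by fun_prop) (by fun_prop)).2
  have hB : spcB ξ t i j = (fun ω => ((ξ i ω, ξ j ω), fun (l : T) => ξ l ω)) ⁻¹' C := by
    ext ω
    simp [spcB, C, T, S]
  have hPB : P (spcB ξ t i j) =
      ∫⁻ p, Measure.pi (fun _ : T => μ) (Prod.mk p ⁻¹' C) ∂(μ.prod μ) := by
    rw [hB, ← Measure.map_apply (mp.prodMk mT) hC, hlaw2, Measure.prod_apply hC]
  have hg : Measurable fun p => Measure.pi (fun _ : T => μ) (Prod.mk p ⁻¹' C) :=
    measurable_measure_prodMk_left hC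
  have hfin : ∫⁻ p, Measure.pi (fun _ : T => μ) (Prod.mk p ⁻¹' C) ∂(μ.prod μ) ≠ ⊤ := by
    rw [← hPB]; exact measure_ne_top _ _
  have hint := integrable_toReal_of_lintegral_ne_top hg.aemeasurable hfin
  rw [measureReal_def, hPB, ← integral_toReal hg.aemeasurable
    (Eventually.of_forall fun p => measure_lt_top _ _), integral_prod _ hint]
  refine integral_congr_ae (Eventually.of_forall fun y => ?_)
  simp only
  rw [← integral_indicator measurableSet_Ioi]
  refine integral_congr_ae (Eventually.of_forall fun z => ?_)
  simp only
  by_cases hz : y + t < z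
  · rw [Set.indicator_of_mem (by exact hz)]
    have hsec : Prod.mk (y, z) ⁻¹' C =
        Set.univ.pi fun _ : T => (Set.Ioc y (y + t) ∪ Set.Ioc z (z + t))ᶜ := by
      ext v
      simp only [C, Set.mem_preimage, Set.mem_ofPred_eq, Set.mem_pi, Set.mem_univ, true_imp_iff,
        Set.mem_compl_iff, Set.mem_union, Set.mem_Ioc, hz, true_and]
    have hd : Disjoint (Set.Ioc y (y + t)) (Set.Ioc z (z + t)) := by
      rw [Set.disjoint_left]
      rintro x ⟨_, h1⟩ ⟨h2, _⟩
      linarith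
    rw [hsec, Measure.pi_pi, Finset.prod_const, Finset.card_univ, Fintype.card_coe, hT,
      ENNReal.toReal_pow]
    congr 1
    have := probReal_compl_eq_one_sub (μ := μ)
      (measurableSet_Ioc.union measurableSet_Ioc : MeasurableSet (Set.Ioc y (y + t) ∪ Set.Ioc z (z + t)))
    rw [measureReal_union hd measurableSet_Ioc] at this
    simp only [measureReal_def] at this
    rw [this]; ring
  · rw [Set.indicator_of_notMem (by exact hz)]
    have hsec : Prod.mk (y, z) ⁻¹' C = ∅ := by
      ext v; simp [C, hz]
    simp [hsec]

lemma spc_ne {Ω : Type*} [MeasurableSpace Ω] (P : Measure Ω) [IsProbabilityMeasure P]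
    (k : ℕ) (μ : Measure ℝ) [IsProbabilityMeasure μ] [NullSingletonClass μ]
    (ξ : Fin k → Ω → ℝ) (hmeas : ∀ i, Measurable (ξ i))
    (hindep : iIndepFun ξ P)
    (hlaw : ∀ i, Measure.map (ξ i) P = μ) (i j : Fin k) (hij : i ≠ j) :
    ∀ᵐ ω ∂P, ξ i ω ≠ ξ j ω := by
  have h := (indepFun_iff_map_prod_eq_prod_map_map (hmeas i).aemeasurable
      (hmeas j).aemeasurable).1 (hindep.indepFun hij)
  rw [hlaw, hlaw] at h
  have hD : MeasurableSet {p : ℝ × ℝ | p.1 = p.2} :=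
    measurableSet_eq_fun measurable_fst measurable_snd
  have : P {ω | ξ i ω = ξ j ω} = 0 := by
    have e : {ω | ξ i ω = ξ j ω} = (fun ω => (ξ i ω, ξ j ω)) ⁻¹' {p : ℝ × ℝ | p.1 = p.2} := rfl
    rw [e, ← Measure.map_apply ((hmeas i).prodMk (hmeas j)) hD, h, Measure.prod_apply hD]
    have : ∀ x : ℝ, Prod.mk x ⁻¹' {p : ℝ × ℝ | p.1 = p.2} = {x} := by
      intro x; ext y; simp [eq_comm]
    simp [this]
  rw [ae_iff]
  simpa using this

/-- Second factorial moment formula for the number of sample points among `k` i.i.d. points of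
an atomless law `μ` having no other sample point in the half-open interval of length `t` to
their right. -/
theorem second_factorial_moment_spacing_count
    {Ω : Type*} [MeasurableSpace Ω] (P : Measure Ω) [IsProbabilityMeasure P]
    (k : ℕ) (hk : 2 ≤ k) (μ : Measure ℝ) [IsProbabilityMeasure μ] [NullSingletonClass μ]
    (ξ : Fin k → Ω → ℝ) (hmeas : ∀ i, Measurable (ξ i))
    (hindep : iIndepFun ξ P)
    (hlaw : ∀ i, Measure.map (ξ i) P = μ)
    (t : ℝ) (ht : 0 < t) :
    ∫ ω, (((Finset.univ.filter fun i : Fin k =>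
          ∀ j, j ≠ i → ξ j ω ∉ Set.Ioc (ξ i ω) (ξ i ω + t)).card : ℝ) *
        (((Finset.univ.filter fun i : Fin k =>
          ∀ j, j ≠ i → ξ j ω ∉ Set.Ioc (ξ i ω) (ξ i ω + t)).card : ℝ) - 1)) ∂P
      = 2 * k * ((k : ℝ) - 1) *
        ∫ y, (∫ z in Set.Ioi (y + t),
          (1 - (μ (Set.Ioc y (y + t))).toReal - (μ (Set.Ioc z (z + t))).toReal) ^ (k - 2) ∂μ) ∂μ := by
  classical
  set I := ∫ y, (∫ z in Set.Ioi (y + t),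
          (1 - (μ (Set.Ioc y (y + t))).toReal - (μ (Set.Ioc z (z + t))).toReal) ^ (k - 2) ∂μ) ∂μ
    with hI
  let F : Fin k → Fin k → Ω → ℝ := fun i j ω => if i ≠ j then
    (spcB ξ t i j).indicator 1 ω + (spcB ξ t j i).indicator 1 ω else 0
  have hne : ∀ᵐ ω ∂P, ∀ i j, i ≠ j → ξ i ω ≠ ξ j ω := by
    rw [ae_all_iff]; intro i
    rw [ae_all_iff]; intro j
    by_cases hij : i = j
    · simp [hij]
    · filter_upwards [spc_ne P k μ ξ hmeas hindep hlaw i j hij] with ω h _ using h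
  have h1 : ∀ i j, Integrable ((spcB ξ t i j).indicator (1 : Ω → ℝ)) P := fun i j =>
    (integrable_const (1:ℝ)).indicator (spc_meas ξ hmeas t i j)
  have hF : ∀ i j, Integrable (F i j) P := by
    intro i j
    by_cases hij : i = j
    · simp [F, hij]
    · simp only [F, ne_eq, hij, not_false_eq_true, if_true]
      exact (h1 i j).add (h1 j i)
  have hFI : ∀ i j, ∫ ω, F i j ω ∂P = if i ≠ j then 2 * I else 0 := by
    intro i j
    by_cases hij : i = j
    · simp [F, hij]
    · simp only [F, ne_eq, hij, not_false_eq_true, if_true]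
      rw [integral_add (h1 i j) (h1 j i), integral_indicator_one (spc_meas ξ hmeas t i j),
        integral_indicator_one (spc_meas ξ hmeas t j i),
        spc_prob P k μ ξ hmeas hindep hlaw t ht i j hij,
        spc_prob P k μ ξ hmeas hindep hlaw t ht j i (Ne.symm hij)]
      ring
  calc _ = ∫ ω, ∑ i, ∑ j, F i j ω ∂P := by
        refine integral_congr_ae ?_
        filter_upwards [hne] with ω hω
        rw [spc_card]
        refine Finset.sum_congr rfl fun i _ => Finset.sum_congr rfl fun j _ => ?_
        by_cases hij : i = j
        · simp [F, hij]
        · simp only [F, ne_eq, hij, not_false_eq_true, if_true]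
          have hb := spc_iff ξ t ht i j hij ω (hω i j hij)
          have hx : ¬ (ω ∈ spcB ξ t i j ∧ ω ∈ spcB ξ t j i) := by
            rintro ⟨a, b⟩
            have := a.1
            have := b.1
            linarith
          simp only [ne_eq] at hb
          rw [if_congr hb rfl rfl]
          by_cases a : ω ∈ spcB ξ t i j <;> by_cases b : ω ∈ spcB ξ t j i
          · exact absurd ⟨a, b⟩ hx
          all_goals simp [a, b]
    _ = ∑ i, ∑ j, ∫ ω, F i j ω ∂P := by
        rw [integral_finsetSum _ fun i _ => integrable_finsetSum _ fun j _ => hF i j]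
        exact Finset.sum_congr rfl fun i _ => integral_finsetSum _ fun j _ => hF i j
    _ = 2 * k * ((k : ℝ) - 1) * I := by
        simp only [hFI]
        have : ∀ i : Fin k, ∑ j, (if i ≠ j then 2 * I else 0) = ((k:ℝ) - 1) * (2 * I) := by
          intro i
          have e : ∀ j, (if i ≠ j then 2 * I else 0) = 2 * I - if i = j then 2 * I else 0 := by
            intro j; by_cases h : i = j <;> simp [h]
          simp only [e, Finset.sum_sub_distrib]
          simp
          ring
        simp only [this]
        simp
        ring
end

section
/- Fix x > 0. There exists a constant C = C(x) > 0 such that the following holds: for every integer k ≥ 2, every α ∈ [0,1], and every probability measure μ on [0,1] whose cumulative distribution function Ξ (with Ξ(y) = 0 for y < 0 and Ξ(y) = 1 for y ≥ 1) satisfies (i) |Ξ(y + x/k) − Ξ(y) − x/k| ≤ (x/k)·α for all y ∈ [0, 1 − x/k], and (ii) |Ξ(y + x/k) − Ξ(y)| ≤ (x/k)·(1 + α) for all y ∈ [1 − x/k, 1], one has |∫_{[0,1]} (1 − μ((y, y + x/k]))^{k−1} dμ(y) − e^{−x}| ≤ C(α + 1/k). In particular, if for each k a measure μ_k satisfies (i)–(ii)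 with α = α_k → 0, then ∫ (1 − μ_k((y, y + x/k]))^{k−1} dμ_k(y) → e^{−x} as k → ∞. -/
open MeasureTheory ProbabilityTheory Filter

lemma pow_lip (a b : ℝ) (ha : 0 ≤ a) (ha1 : a ≤ 1) (hb : 0 ≤ b) (hb1 : b ≤ 1) (n : ℕ) :
    |a ^ n - b ^ n| ≤ n * |a - b| := by
  induction n with
  | zero => simp
  | succ n ih =>
    have h : a ^ (n+1) - b ^ (n+1) = a * (a ^ n - b ^ n) + (a - b) * b ^ n := by ring
    rw [h]
    refine (abs_add_le _ _).trans ?_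
    rw [abs_mul, abs_mul, abs_of_nonneg ha, abs_of_nonneg (pow_nonneg hb n)]
    have h1 : b ^ n ≤ 1 := pow_le_one₀ hb hb1
    have h2 := abs_nonneg (a - b)
    have h3 := abs_nonneg (a ^ n - b ^ n)
    push_cast
    nlinarith

lemma exp_part (x : ℝ) (hx : 0 < x) (k : ℕ) (hk : 2 ≤ k) (hxk : x < k) :
    |(1 - x / k) ^ (k - 1) - Real.exp (-x)| ≤ (x ^ 2 + x) / k := by
  have hk0 : (0 : ℝ) < k := by positivity
  set d := x / k with hd
  have hd0 : 0 < d := by positivity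
  have hd1 : d < 1 := by rw [hd, div_lt_one hk0]; exact hxk
  have hxd : x = k * d := by rw [hd]; field_simp
  have he : Real.exp (-x) = Real.exp (-d) ^ (k - 1) * Real.exp (-d) := by
    rw [← pow_succ, Nat.sub_add_cancel (by omega), ← Real.exp_nat_mul, hxd]; ring_nf
  have e0 := Real.exp_pos (-d)
  have e1 : Real.exp (-d) ≤ 1 := Real.exp_le_one_iff.mpr (by linarith)
  have e2 : 1 - d ≤ Real.exp (-d) := by linarith [Real.add_one_le_exp (-d)]
  have e3 : |Real.exp (-d) - 1 - (-d)| ≤ (-d) ^ 2 :=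
    Real.abs_exp_sub_one_sub_id_le (by rw [abs_neg, abs_of_pos hd0]; exact hd1.le)
  have h1 := pow_lip (1 - d) (Real.exp (-d)) (by linarith) (by linarith) e0.le e1 (k - 1)
  have h2 : |1 - d - Real.exp (-d)| ≤ d ^ 2 := by
    rw [abs_sub_comm]; convert e3 using 1 <;> ring_nf
  have hkk : ((k - 1 : ℕ) : ℝ) ≤ k := by exact_mod_cast Nat.sub_le _ _
  have h3 : ((k - 1 : ℕ) : ℝ) * |1 - d - Real.exp (-d)| ≤ k * d ^ 2 := by gcongr
  have p0 : 0 ≤ Real.exp (-d) ^ (k - 1) := by positivity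
  have p1 : Real.exp (-d) ^ (k - 1) ≤ 1 := pow_le_one₀ e0.le e1
  have h4 : |Real.exp (-d) ^ (k - 1) - Real.exp (-x)| ≤ d := by
    rw [he, abs_le]; constructor <;> nlinarith
  have h5 : (x ^ 2 + x) / k = k * d ^ 2 + d := by rw [hd]; field_simp
  rw [h5]
  exact (abs_sub_le _ _ _).trans (by linarith)

lemma main_bound (x : ℝ) (hx : 0 < x) (k : ℕ) (hk : 2 ≤ k) (α : ℝ) (hα : α ∈ Set.Icc (0 : ℝ) 1)
      (μ : Measure ℝ) (hμ : IsProbabilityMeasure μ) (hs : μ (Set.Icc (0 : ℝ) 1) = 1)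
      (h1 : ∀ y ∈ Set.Icc (0 : ℝ) (1 - x / k),
        |(μ (Set.Iic (y + x / k))).toReal - (μ (Set.Iic y)).toReal - x / k| ≤ x / k * α)
      (h2 : ∀ y ∈ Set.Icc (1 - x / k) (1 : ℝ),
        |(μ (Set.Iic (y + x / k))).toReal - (μ (Set.Iic y)).toReal| ≤ x / k * (1 + α)) :
      |(∫ y, (1 - (μ (Set.Ioc y (y + x / k))).toReal) ^ (k - 1) ∂μ) - Real.exp (-x)|
        ≤ (x ^ 2 + 3 * x) * (α + 1 / k) := by
  obtain ⟨hα0, hα1⟩ := hα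
  have hk0 : (0 : ℝ) < k := by positivity
  set d := x / k with hd
  have hd0 : 0 < d := by positivity
  have hm : ∀ y, (μ (Set.Ioc y (y + d))).toReal
      = (μ (Set.Iic (y + d))).toReal - (μ (Set.Iic y)).toReal := by
    intro y
    rw [← Set.Iic_sdiff_Iic]
    exact measureReal_sdiff (μ := μ) (Set.Iic_subset_Iic.mpr (by linarith)) measurableSet_Iic
  have hm0 : ∀ y, 0 ≤ (μ (Set.Ioc y (y + d))).toReal := fun y => ENNReal.toReal_nonneg
  have hm1 : ∀ y, (μ (Set.Ioc y (y + d))).toReal ≤ 1 := fun y => measureReal_le_one (μ := μ)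
  set f : ℝ → ℝ := fun y => (1 - (μ (Set.Ioc y (y + d))).toReal) ^ (k - 1) with hf
  have hf0 : ∀ y, 0 ≤ f y := fun y => pow_nonneg (by linarith [hm1 y]) _
  have hf1 : ∀ y, f y ≤ 1 := fun y => pow_le_one₀ (by linarith [hm1 y]) (by linarith [hm0 y])
  have hmono : Monotone (fun y => (μ (Set.Iic y)).toReal) := fun a b hab =>
    measureReal_mono (μ := μ) (Set.Iic_subset_Iic.mpr hab)
  have hfm : Measurable f := by
    have : f = fun y => (1 - ((μ (Set.Iic (y + d))).toReal - (μ (Set.Iic y)).toReal)) ^ (k - 1) := by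
      funext y; rw [hf]; simp only [hm]
    rw [this]
    have a1 := hmono.measurable
    have a2 : Measurable (fun y => (μ (Set.Iic (y + d))).toReal) :=
      a1.comp (measurable_id.add_const d)
    exact (measurable_const.sub (a2.sub a1)).pow_const _
  have hfi : Integrable f μ := Integrable.of_bound hfm.aestronglyMeasurable 1
    (Eventually.of_forall fun y => by rw [Real.norm_eq_abs, abs_of_nonneg (hf0 y)]; exact hf1 y)
  rcases le_or_gt (k : ℝ) x with hkx | hkx
  · have i0 : 0 ≤ ∫ y, f y ∂μ := integral_nonneg hf0
    have i1 : ∫ y, f y ∂μ ≤ 1 := by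
      have := integral_mono hfi (integrable_const 1) hf1
      simpa using this
    have e0 := Real.exp_pos (-x)
    have e1 : Real.exp (-x) ≤ 1 := Real.exp_le_one_iff.mpr (by linarith)
    have : 1 ≤ d := by rw [hd, one_le_div hk0]; exact hkx
    have h5 : (x ^ 2 + 3 * x) * (α + 1 / k) = (x ^ 2 + 3 * x) * α + (x * d + 3 * d) := by
      rw [hd]; field_simp
    rw [h5, abs_le]
    have : 0 ≤ (x ^ 2 + 3 * x) * α := by positivity
    have : 0 ≤ x * d := by positivity
    constructor <;> linarith
  · have hd1 : d < 1 := by rw [hd, div_lt_one hk0]; exact hkx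
    have hxd : x = k * d := by rw [hd]; field_simp
    set c := (1 - d) ^ (k - 1) with hc
    have c0 : 0 ≤ c := pow_nonneg (by linarith) _
    have c1 : c ≤ 1 := pow_le_one₀ (by linarith) (by linarith)
    have hkk : ((k - 1 : ℕ) : ℝ) ≤ k := by exact_mod_cast Nat.sub_le _ _
    let S : Set ℝ := Set.Ioc (1 - d) (1 - d + d)
    have hS : MeasurableSet S := measurableSet_Ioc
    have hae : ∀ᵐ y ∂μ, y ∈ Set.Icc (0 : ℝ) 1 :=
      (prob_compl_eq_zero_iff measurableSet_Icc).mpr hs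
    have hpt : ∀ᵐ y ∂μ, ‖f y - c‖ ≤ x * α + S.indicator 1 y := by
      filter_upwards [hae] with y hy
      rw [Real.norm_eq_abs]
      rcases le_or_gt y (1 - d) with hyd | hyd
      · have a := h1 y ⟨hy.1, hyd⟩
        rw [← hm] at a
        have b := pow_lip (1 - (μ (Set.Ioc y (y + d))).toReal) (1 - d) (by linarith [hm1 y])
          (by linarith [hm0 y]) (by linarith) (by linarith) (k - 1)
        have hS0 : (0 : ℝ) ≤ S.indicator 1 y := Set.indicator_nonneg (by simp) _
        have e : |1 - (μ (Set.Ioc y (y + d))).toReal - (1 - d)| ≤ d * α := by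
          rw [abs_sub_comm]; convert a using 2; ring
        have : ((k - 1 : ℕ) : ℝ) * |1 - (μ (Set.Ioc y (y + d))).toReal - (1 - d)| ≤ k * (d * α) := by
          gcongr
        have h' : x * α = k * (d * α) := by rw [← mul_assoc, ← hxd]
        rw [h']
        exact b.trans (by linarith)
      · have : S.indicator (1 : ℝ → ℝ) y = 1 := by
          rw [Set.indicator_of_mem]; · rfl
          exact ⟨hyd, by linarith [hy.2]⟩
        rw [this, abs_le]
        have : 0 ≤ x * α := by positivity
        constructor <;> linarith [hf0 y, hf1 y]
    have hSi : Integrable (S.indicator (1 : ℝ → ℝ)) μ := (integrable_const (1:ℝ)).indicator hS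
    have hI : ‖∫ y, (f y - c) ∂μ‖ ≤ ∫ y, (x * α + S.indicator 1 y) ∂μ :=
      norm_integral_le_of_norm_le ((integrable_const _).add hSi) hpt
    rw [integral_add (integrable_const _) hSi, integral_sub hfi (integrable_const _),
      integral_indicator_one hS] at hI
    simp only [integral_const, probReal_univ, one_smul] at hI
    have hSb : μ.real S ≤ 2 * d := by
      have a := h2 (1 - d) ⟨le_refl _, by linarith⟩
      rw [← hm] at a
      have := (le_abs_self _).trans a
      have h' : μ.real S = (μ (Set.Ioc (1 - d) (1 - d + d))).toReal := rfl
      rw [h']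
      nlinarith
    have hE := exp_part x hx k hk hkx
    rw [← hd, ← hc] at hE
    rw [Real.norm_eq_abs] at hI
    have h5 : (x ^ 2 + 3 * x) * (α + 1 / k)
        = (x ^ 2 + 2 * x) * α + x * α + ((x ^ 2 + x) / k + 2 * d) := by
      rw [hd]; field_simp; ring
    have : 0 ≤ (x ^ 2 + 2 * x) * α := by positivity
    rw [h5]
    exact (abs_sub_le _ c _).trans (by linarith)

/-- If the distribution function of a probability measure `μ` on `[0,1]` is nearly uniform at
scale `x/k` with relative error `α`, then the expected proportion of spacings larger than `x/k`
among `k` i.i.d. points of law `μ` is within `C (α + 1/k)` of `e^{-x}`.  In particular, if for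
each `k` a measure `μ_k` satisfies these hypotheses with `α = α_k → 0`, then the corresponding
integrals converge to `e^{-x}`. -/
theorem spacing_integral_close_to_exp (x : ℝ) (hx : 0 < x) :
    (∃ C > (0 : ℝ), ∀ (k : ℕ), 2 ≤ k → ∀ α ∈ Set.Icc (0 : ℝ) 1,
      ∀ (μ : Measure ℝ), IsProbabilityMeasure μ → μ (Set.Icc (0 : ℝ) 1) = 1 →
      (∀ y ∈ Set.Icc (0 : ℝ) (1 - x / k),
        |(μ (Set.Iic (y + x / k))).toReal - (μ (Set.Iic y)).toReal - x / k| ≤ x / k * α) →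
      (∀ y ∈ Set.Icc (1 - x / k) (1 : ℝ),
        |(μ (Set.Iic (y + x / k))).toReal - (μ (Set.Iic y)).toReal| ≤ x / k * (1 + α)) →
      |(∫ y, (1 - (μ (Set.Ioc y (y + x / k))).toReal) ^ (k - 1) ∂μ) - Real.exp (-x)|
        ≤ C * (α + 1 / k)) ∧
    (∀ (μs : ℕ → Measure ℝ) (αs : ℕ → ℝ),
      (∀ k, IsProbabilityMeasure (μs k)) → (∀ k, μs k (Set.Icc (0 : ℝ) 1) = 1) →
      (∀ k, αs k ∈ Set.Icc (0 : ℝ) 1) →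
      (∀ k : ℕ, 2 ≤ k →
        (∀ y ∈ Set.Icc (0 : ℝ) (1 - x / k),
          |(μs k (Set.Iic (y + x / k))).toReal - (μs k (Set.Iic y)).toReal - x / k|
            ≤ x / k * αs k) ∧
        (∀ y ∈ Set.Icc (1 - x / k) (1 : ℝ),
          |(μs k (Set.Iic (y + x / k))).toReal - (μs k (Set.Iic y)).toReal|
            ≤ x / k * (1 + αs k))) →
      Tendsto αs atTop (nhds 0) →
      Tendsto (fun k : ℕ => ∫ y, (1 - (μs k (Set.Ioc y (y + x / k))).toReal) ^ (k - 1) ∂(μs k))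
        atTop (nhds (Real.exp (-x)))) := by
  refine ⟨⟨x ^ 2 + 3 * x, by positivity, fun k hk α hα μ hμ hs h1 h2 =>
    main_bound x hx k hk α hα μ hμ hs h1 h2⟩, ?_⟩
  intro μs αs hμ hs hα h hlim
  rw [tendsto_iff_dist_tendsto_zero]
  have hz : Tendsto (fun k : ℕ => (x ^ 2 + 3 * x) * (αs k + 1 / (k : ℝ))) atTop (nhds 0) := by
    have := (hlim.add tendsto_one_div_atTop_nhds_zero_nat).const_mul (x ^ 2 + 3 * x)
    simpa using this
  refine squeeze_zero' (Eventually.of_forall fun _ => dist_nonneg) ?_ hz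
  filter_upwards [eventually_ge_atTop 2] with k hk
  rw [Real.dist_eq]
  exact main_bound x hx k hk (αs k) (hα k) (μs k) (hμ k) (hs k) (h k hk).1 (h k hk).2
end

section
/- Fix x > 0 and C₀ ≥ 1. There exists a constant C > 0 such that the following holds: for every integer k ≥ 2 and every atomless probability measure μ on [0,1] satisfying μ((y, y + x/k]) ≤ C₀·x/k for all y ∈ ℝ, if ξ_1, …, ξ_k are i.i.d. with law μ, t = x/k, N_t denotes the number of indices i ∈ {1,…,k} such that no other sample point ξ_j (j ≠ i) lies in the half-open interval (ξ_i, ξ_i + t], and D := ∫ (1 − μ((y, y+t]))^{k−1} dμ(y), then E[(N_t/k − D)²] ≤ C/k. -/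
open MeasureTheory ProbabilityTheory Filter

lemma aux_prob {Ω α : Type*} [MeasurableSpace Ω] [MeasurableSpace α] {k : ℕ} {P : Measure Ω}
    [IsProbabilityMeasure P] {μ : Measure ℝ} [IsProbabilityMeasure μ] {ξ : Fin k → Ω → ℝ}
    (hm : ∀ i, Measurable (ξ i)) (hi : iIndepFun ξ P) (hl : ∀ i, Measure.map (ξ i) P = μ)
    (T : Finset (Fin k)) (X : Ω → α) (hX : Measurable X)
    (hXT : IndepFun X (fun ω (l : T) => ξ l ω) P)
    (G : Set (α × ℝ)) (hG : MeasurableSet G) :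
    P.real {ω | ∀ l ∈ T, (X ω, ξ l ω) ∉ G}
      = ∫ ω, (μ.real {w | (X ω, w) ∉ G}) ^ T.card ∂P := by
  have hY : Measurable (fun ω (l : T) => ξ l ω) := by fun_prop
  have hsec : ∀ a, MeasurableSet {w | (a, w) ∉ G} := fun a =>
    (measurable_prodMk_left (x := a) hG).compl
  have hE : MeasurableSet {p : α × (T → ℝ) | ∀ l, (p.1, p.2 l) ∉ G} := by
    rw [Set.ofPred_forall]
    refine MeasurableSet.iInter fun l => ?_
    have : Measurable (fun p : α × (T → ℝ) => (p.1, p.2 l)) := by fun_prop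
    exact (this hG).compl
  have h1 : P {ω | ∀ l ∈ T, (X ω, ξ l ω) ∉ G}
      = P.map (fun ω => (X ω, fun l : T => ξ l ω)) {p : α × (T → ℝ) | ∀ l, (p.1, p.2 l) ∉ G} := by
    rw [Measure.map_apply (hX.prodMk hY) hE]
    congr 1; ext ω; simp
  have h2 : ∀ a, P.map (fun ω (l : T) => ξ l ω)
      (Prod.mk a ⁻¹' {p : α × (T → ℝ) | ∀ l, (p.1, p.2 l) ∉ G})
      = (μ {w | (a, w) ∉ G}) ^ T.card := by
    intro a
    rw [Measure.map_apply hY (measurable_prodMk_left hE)]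
    have := hi.measure_inter_preimage_eq_mul T (sets := fun _ => {w | (a, w) ∉ G})
      (fun i _ => hsec a)
    have h3 : ∀ i ∈ T, P (ξ i ⁻¹' {w | (a, w) ∉ G}) = μ {w | (a, w) ∉ G} := by
      intro i _
      rw [← hl i, Measure.map_apply (hm i) (hsec a)]
    rw [Finset.prod_congr rfl h3, Finset.prod_const] at this
    rw [← this]
    congr 1; ext ω; simp
  have hmeas : Measurable fun a => μ {w | (a, w) ∉ G} :=
    measurable_measure_prodMk_left hG.compl
  rw [measureReal_def, h1, (indepFun_iff_map_prod_eq_prod_map_map hX.aemeasurable hY.aemeasurable).1 hXT]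
  have : IsProbabilityMeasure (P.map (fun ω (l : T) => ξ l ω)) :=
    Measure.isProbabilityMeasure_map hY.aemeasurable
  rw [Measure.prod_apply hE]
  simp_rw [h2]
  rw [lintegral_map (hmeas.pow_const _) hX, ← integral_toReal]
  · simp [measureReal_def]
  · exact ((hmeas.pow_const _).comp hX).aemeasurable
  · exact Eventually.of_forall fun ω => ENNReal.pow_lt_top (measure_lt_top _ _)

lemma aux_main {Ω : Type*} [MeasurableSpace Ω] {k : ℕ} (hk : 2 ≤ k) {P : Measure Ω}
    [IsProbabilityMeasure P] {μ : Measure ℝ} [IsProbabilityMeasure μ] [NullSingletonClass μ]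
    {ξ : Fin k → Ω → ℝ}
    (hm : ∀ i, Measurable (ξ i)) (hi : iIndepFun ξ P) (hl : ∀ i, Measure.map (ξ i) P = μ)
    (t : ℝ) (i : Fin k) :
    P.real {ω | ∀ j, j ≠ i → ξ j ω ∉ Set.Ioc (ξ i ω) (ξ i ω + t)}
      = ∫ y, (1 - (μ (Set.Ioc y (y + t))).toReal) ^ (k - 1) ∂μ := by
  have hG : MeasurableSet {p : ℝ × ℝ | p.2 ∈ Set.Ioc p.1 (p.1 + t)} :=
    (measurableSet_lt measurable_fst measurable_snd).inter
      (measurableSet_le measurable_snd (by fun_prop))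
  have hind := hi.indepFun_finset {i} ({i}ᶜ) (by simp [disjoint_compl_right]) hm
  have hind' : IndepFun (ξ i) (fun ω (l : ({i}ᶜ : Finset (Fin k))) => ξ l ω) P :=
    hind.comp (φ := fun u : (({i} : Finset (Fin k)) → ℝ) => u ⟨i, Finset.mem_singleton_self i⟩) (ψ := id)
      (measurable_pi_apply _) measurable_id
  have := aux_prob hm hi hl ({i}ᶜ) (ξ i) (hm i) hind' _ hG
  have hc : ({i}ᶜ : Finset (Fin k)).card = k - 1 := by simp [Finset.card_compl]
  rw [hc] at this
  have h1 : ∀ y, μ.real {w | (y, w) ∉ {p : ℝ × ℝ | p.2 ∈ Set.Ioc p.1 (p.1 + t)}}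
      = 1 - (μ (Set.Ioc y (y + t))).toReal := fun y =>
    probReal_compl_eq_one_sub (s := Set.Ioc y (y + t)) measurableSet_Ioc
  have hq : Measurable fun y => μ.real (Set.Ioc y (y + t)) :=
    (measurable_measure_prodMk_left hG).ennreal_toReal
  simp_rw [h1] at this
  have h2 := integral_map (μ := P) (φ := ξ i)
    (f := fun y => (1 - (μ (Set.Ioc y (y + t))).toReal) ^ (k - 1)) (hm i).aemeasurable
    ((measurable_const.sub hq).pow_const _).aestronglyMeasurable
  rw [hl i] at h2
  rw [h2, ← this]
  simp

lemma aux_pair {Ω : Type*} [MeasurableSpace Ω] {k : ℕ} (hk : 2 ≤ k) {P : Measure Ω}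
    [IsProbabilityMeasure P] {μ : Measure ℝ} [IsProbabilityMeasure μ] [NullSingletonClass μ]
    {ξ : Fin k → Ω → ℝ}
    (hm : ∀ i, Measurable (ξ i)) (hi : iIndepFun ξ P) (hl : ∀ i, Measure.map (ξ i) P = μ)
    (t : ℝ) (ht : 0 < t) (i j : Fin k) (hij : i ≠ j) :
    P.real ({ω | ∀ l, l ≠ i → ξ l ω ∉ Set.Ioc (ξ i ω) (ξ i ω + t)} ∩
      {ω | ∀ l, l ≠ j → ξ l ω ∉ Set.Ioc (ξ j ω) (ξ j ω + t)})
      ≤ (∫ y, (1 - (μ (Set.Ioc y (y + t))).toReal) ^ (k - 2) ∂μ) ^ 2 := by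
  have hG0 : MeasurableSet {p : ℝ × ℝ | p.2 ∈ Set.Ioc p.1 (p.1 + t)} :=
    (measurableSet_lt measurable_fst measurable_snd).inter
      (measurableSet_le measurable_snd (by fun_prop))
  have hq : Measurable fun y => μ.real (Set.Ioc y (y + t)) :=
    (measurable_measure_prodMk_left hG0).ennreal_toReal
  let G : Set ((ℝ × ℝ) × ℝ) := {p | |p.1.1 - p.1.2| ≤ t} ∪
    ({p | p.2 ∈ Set.Ioc p.1.1 (p.1.1 + t)} ∪ {p | p.2 ∈ Set.Ioc p.1.2 (p.1.2 + t)})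
  have hG : MeasurableSet G := by
    have m1 : Measurable fun p : (ℝ × ℝ) × ℝ => p.1.1 := by fun_prop
    have m2 : Measurable fun p : (ℝ × ℝ) × ℝ => p.1.2 := by fun_prop
    have m3 : Measurable fun p : (ℝ × ℝ) × ℝ => p.2 := by fun_prop
    have m4 : Measurable fun p : (ℝ × ℝ) × ℝ => |p.1.1 - p.1.2| := by fun_prop
    refine (measurableSet_le m4 measurable_const).union (MeasurableSet.union ?_ ?_)
    · exact (measurableSet_lt m1 m3).inter (measurableSet_le m3 (m1.add_const t))
    · exact (measurableSet_lt m2 m3).inter (measurableSet_le m3 (m2.add_const t))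
  have hind := hi.indepFun_finset {i, j} ({i, j}ᶜ) disjoint_compl_right hm
  have hind' : IndepFun (fun ω => (ξ i ω, ξ j ω))
      (fun ω (l : ({i, j}ᶜ : Finset (Fin k))) => ξ l ω) P :=
    hind.comp (φ := fun u : (({i, j} : Finset (Fin k)) → ℝ) =>
      (u ⟨i, Finset.mem_insert_self _ _⟩, u ⟨j, Finset.mem_insert_of_mem (Finset.mem_singleton_self j)⟩))
      (ψ := id) ((measurable_pi_apply _).prodMk (measurable_pi_apply _))
      measurable_id
  have key := aux_prob hm hi hl ({i, j}ᶜ) _ ((hm i).prodMk (hm j)) hind' _ hG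
  have hc : ({i, j}ᶜ : Finset (Fin k)).card = k - 2 := by
    rw [Finset.card_compl, Finset.card_pair hij, Fintype.card_fin]
  rw [hc] at key
  have hijind : IndepFun (ξ i) (ξ j) P := hi.indepFun hij
  -- ties are null
  have hne : ∀ᵐ ω ∂P, ξ i ω ≠ ξ j ω := by
    have hd : MeasurableSet {p : ℝ × ℝ | p.1 = p.2} :=
      measurableSet_eq_fun measurable_fst measurable_snd
    have : P.map (fun ω => (ξ i ω, ξ j ω)) {p : ℝ × ℝ | p.1 = p.2} = 0 := by
      rw [(indepFun_iff_map_prod_eq_prod_map_map (hm i).aemeasurable (hm j).aemeasurable).1 hijind,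
        hl, hl, Measure.prod_apply hd]
      have : ∀ x : ℝ, μ (Prod.mk x ⁻¹' {p : ℝ × ℝ | p.1 = p.2}) = 0 := by
        intro x
        have : Prod.mk x ⁻¹' {p : ℝ × ℝ | p.1 = p.2} = {x} := by
          ext z; simp [eq_comm]
        rw [this]; simp
      simp [this]
    rw [Measure.map_apply ((hm i).prodMk (hm j)) hd] at this
    rw [ae_iff]
    simpa using this
  have hle : P.real ({ω | ∀ l, l ≠ i → ξ l ω ∉ Set.Ioc (ξ i ω) (ξ i ω + t)} ∩
      {ω | ∀ l, l ≠ j → ξ l ω ∉ Set.Ioc (ξ j ω) (ξ j ω + t)}) ≤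
      P.real {ω | ∀ l ∈ ({i, j}ᶜ : Finset (Fin k)), ((ξ i ω, ξ j ω), ξ l ω) ∉ G} := by
    refine ENNReal.toReal_mono (measure_ne_top _ _) (measure_mono_ae ?_)
    filter_upwards [hne] with ω hω
    rintro ⟨h1, h2⟩ l hlT
    simp only [Finset.mem_compl, Finset.mem_insert, Finset.mem_singleton, not_or] at hlT
    have a1 := h1 l hlT.1
    have a2 := h2 l hlT.2
    have a3 := h1 j hij.symm
    have a4 := h2 i hij
    simp only [G, Set.mem_union, Set.mem_ofPred_eq, not_or]
    refine ⟨?_, a1, a2⟩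
    simp only [Set.mem_Ioc, not_and, not_le] at a3 a4
    rw [not_le, lt_abs]
    rcases lt_or_gt_of_ne hω with h | h
    · right; linarith [a3 h]
    · left; linarith [a4 h]
  refine hle.trans (key.le.trans ?_)
  have hq1 : ∀ y, μ.real (Set.Ioc y (y + t)) ≤ 1 := fun y => measureReal_le_one
  have hq0 : ∀ y, 0 ≤ μ.real (Set.Ioc y (y + t)) := fun y => measureReal_nonneg
  have hpt : ∀ y z, μ.real {w | ((y, z), w) ∉ G} ≤
      (1 - μ.real (Set.Ioc y (y + t))) * (1 - μ.real (Set.Ioc z (z + t))) := by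
    intro y z
    by_cases h : |y - z| ≤ t
    · have : {w | ((y, z), w) ∉ G} = ∅ := by
        ext w; simp [G, h]
      rw [this]
      simp only [measureReal_empty]
      exact mul_nonneg (by linarith [hq1 y]) (by linarith [hq1 z])
    · have : {w | ((y, z), w) ∉ G} = (Set.Ioc y (y + t) ∪ Set.Ioc z (z + t))ᶜ := by
        ext w; simp only [G, Set.mem_union, Set.mem_ofPred_eq, h, false_or, Set.mem_compl_iff]
      have hdis : Disjoint (Set.Ioc y (y + t)) (Set.Ioc z (z + t)) := by
        rw [Set.disjoint_left]
        rintro w ⟨b1, b2⟩ ⟨b3, b4⟩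
        apply h
        rw [abs_le]; constructor <;> linarith
      rw [this, probReal_compl_eq_one_sub (measurableSet_Ioc.union measurableSet_Ioc),
        measureReal_union hdis measurableSet_Ioc]
      nlinarith [mul_nonneg (hq0 y) (hq0 z)]
  let f : ℝ → ℝ := fun y => (1 - μ.real (Set.Ioc y (y + t))) ^ (k - 2)
  have hf : Measurable f := (measurable_const.sub hq).pow_const _
  have hf0 : ∀ y, 0 ≤ f y := fun y => pow_nonneg (by linarith [hq1 y]) _
  have hf1 : ∀ y, f y ≤ 1 := fun y =>
    pow_le_one₀ (by linarith [hq1 y]) (by linarith [hq0 y])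
  have hint : ∫ ω, f (ξ i ω) * f (ξ j ω) ∂P = (∫ y, f y ∂μ) ^ 2 := by
    have := (hijind.comp hf hf).integral_mul_eq_mul_integral
      (hf.comp (hm i)).aestronglyMeasurable (hf.comp (hm j)).aestronglyMeasurable
    have e : ∀ i, ∫ ω, f (ξ i ω) ∂P = ∫ y, f y ∂μ := by
      intro i
      rw [← integral_map (f := f) (hm i).aemeasurable hf.aestronglyMeasurable, hl i]
    calc _ = (∫ ω, f (ξ i ω) ∂P) * ∫ ω, f (ξ j ω) ∂P := this
      _ = _ := by rw [e, e, sq]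
  change _ ≤ (∫ y, f y ∂μ) ^ 2
  rw [← hint]
  refine integral_mono_of_nonneg (Eventually.of_forall fun ω => by positivity) ?_
    (Eventually.of_forall fun ω => ?_)
  · refine Integrable.of_bound (C := 1)
      ((hf.comp (hm i)).mul (hf.comp (hm j))).aestronglyMeasurable
      (Eventually.of_forall fun ω => ?_)
    change ‖f (ξ i ω) * f (ξ j ω)‖ ≤ 1
    rw [Real.norm_of_nonneg (mul_nonneg (hf0 _) (hf0 _))]
    exact mul_le_one₀ (hf1 _) (hf0 _) (hf1 _)
  · simp only [f, ← mul_pow]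
    exact pow_le_pow_left₀ measureReal_nonneg (hpt _ _) _

theorem spacing_count_variance_bound (x : ℝ) (hx : 0 < x) (C₀ : ℝ) (hC₀ : 1 ≤ C₀) :
    ∃ C > (0 : ℝ), ∀ (k : ℕ), 2 ≤ k →
      ∀ (μ : Measure ℝ), IsProbabilityMeasure μ → NoAtoms μ → μ (Set.Icc (0 : ℝ) 1) = 1 →
      (∀ y : ℝ, (μ (Set.Ioc y (y + x / k))).toReal ≤ C₀ * x / k) →
      ∀ (Ω : Type) [MeasurableSpace Ω] (P : Measure Ω), IsProbabilityMeasure P →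
      ∀ (ξ : Fin k → Ω → ℝ), (∀ i, Measurable (ξ i)) →
      iIndepFun ξ P →
      (∀ i, Measure.map (ξ i) P = μ) →
      ∫ ω, (((Finset.univ.filter fun i : Fin k =>
            ∀ j, j ≠ i → ξ j ω ∉ Set.Ioc (ξ i ω) (ξ i ω + x / k)).card : ℝ) / k
          - ∫ y, (1 - (μ (Set.Ioc y (y + x / k))).toReal) ^ (k - 1) ∂μ) ^ 2 ∂P
        ≤ C / k := by
  refine ⟨1 + 2 * (C₀ * x), by positivity, ?_⟩
  intro k hk μ hμ hna _ hub Ω _ P hP ξ hm hi hl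
  have : NullSingletonClass μ := hna
  have hk0 : (0 : ℝ) < k := by positivity
  set t := x / k with ht
  have htpos : 0 < t := by positivity
  set D := ∫ y, (1 - (μ (Set.Ioc y (y + t))).toReal) ^ (k - 1) ∂μ with hD
  set D' := ∫ y, (1 - (μ (Set.Ioc y (y + t))).toReal) ^ (k - 2) ∂μ with hD'
  let A : Fin k → Set Ω := fun i => {ω | ∀ j, j ≠ i → ξ j ω ∉ Set.Ioc (ξ i ω) (ξ i ω + t)}
  have hA : ∀ i, MeasurableSet (A i) := by
    intro i
    simp only [A, Set.ofPred_forall]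
    refine MeasurableSet.iInter fun j => MeasurableSet.iInter fun _ => ?_
    exact ((measurableSet_lt (hm i) (hm j)).inter
      (measurableSet_le (hm j) ((hm i).add_const t))).compl
  have hPA : ∀ i, P.real (A i) = D := fun i => aux_main hk hm hi hl t i
  have hPAA : ∀ i j, i ≠ j → P.real (A i ∩ A j) ≤ D' ^ 2 := fun i j hij =>
    aux_pair hk hm hi hl t htpos i j hij
  have hG0 : MeasurableSet {p : ℝ × ℝ | p.2 ∈ Set.Ioc p.1 (p.1 + t)} :=
    (measurableSet_lt measurable_fst measurable_snd).inter
      (measurableSet_le measurable_snd (by fun_prop))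
  have hq : Measurable fun y => (μ (Set.Ioc y (y + t))).toReal :=
    (measurable_measure_prodMk_left hG0).ennreal_toReal
  have hq1 : ∀ y, (μ (Set.Ioc y (y + t))).toReal ≤ 1 := fun y => measureReal_le_one
  have hq0 : ∀ y, 0 ≤ (μ (Set.Ioc y (y + t))).toReal := fun y => measureReal_nonneg
  have hp0 : ∀ n y, 0 ≤ (1 - (μ (Set.Ioc y (y + t))).toReal) ^ n :=
    fun n y => pow_nonneg (by linarith [hq1 y]) _
  have hp1 : ∀ n y, (1 - (μ (Set.Ioc y (y + t))).toReal) ^ n ≤ 1 := fun n y =>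
    pow_le_one₀ (by linarith [hq1 y]) (by linarith [hq0 y])
  have hint : ∀ n : ℕ, Integrable (fun y => (1 - (μ (Set.Ioc y (y + t))).toReal) ^ n) μ := by
    intro n
    refine Integrable.of_bound (C := 1)
      ((measurable_const.sub hq).pow_const _).aestronglyMeasurable
      (Eventually.of_forall fun y => ?_)
    rw [Real.norm_of_nonneg (hp0 n y)]; exact hp1 n y
  have hD0 : 0 ≤ D := integral_nonneg (hp0 _)
  have hD'0 : 0 ≤ D' := integral_nonneg (hp0 _)
  have hD1 : D ≤ 1 := by
    simpa using integral_mono (hint (k-1)) (integrable_const (1:ℝ)) (hp1 (k-1))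
  have hD'1 : D' ≤ 1 := by
    simpa using integral_mono (hint (k-2)) (integrable_const (1:ℝ)) (hp1 (k-2))
  have hDD : D' - D ≤ C₀ * x / k := by
    rw [hD, hD', ← integral_sub (hint _) (hint _)]
    have := integral_mono ((hint (k-2)).sub (hint (k-1)))
      (integrable_const (C₀ * x / k : ℝ)) (fun y => by
        simp only [Pi.sub_apply]
        have e : k - 1 = (k - 2) + 1 := by omega
        rw [e, pow_succ]
        nlinarith [hp0 (k-2) y, hp1 (k-2) y, hq0 y, hub y])
    simpa using this
  have hDD2 : D' ^ 2 - D ^ 2 ≤ 2 * (C₀ * x / k) := by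
    have : 0 ≤ C₀ * x / k := by positivity
    nlinarith
  let Z : Fin k → Ω → ℝ := fun i => (A i).indicator 1
  have hZint : ∀ i, Integrable (Z i) P := fun i =>
    (integrable_const (1 : ℝ)).indicator (hA i)
  have hZE : ∀ i, ∫ ω, Z i ω ∂P = D := fun i => by
    rw [← hPA i]; exact integral_indicator_one (hA i)
  have hZZ : ∀ i j, (fun ω => Z i ω * Z j ω) = (A i ∩ A j).indicator 1 := by
    intro i j; ext ω
    by_cases h1 : ω ∈ A i <;> by_cases h2 : ω ∈ A j <;> simp [Z, h1, h2]
  have hZZint : ∀ i j, Integrable (fun ω => Z i ω * Z j ω) P := fun i j => by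
    rw [hZZ]; exact (integrable_const (1 : ℝ)).indicator ((hA i).inter (hA j))
  have hZZE : ∀ i j, ∫ ω, Z i ω * Z j ω ∂P = P.real (A i ∩ A j) := fun i j => by
    rw [hZZ]; exact integral_indicator_one ((hA i).inter (hA j))
  have hcard : ∀ ω, (((Finset.univ.filter fun i : Fin k =>
            ∀ j, j ≠ i → ξ j ω ∉ Set.Ioc (ξ i ω) (ξ i ω + t)).card : ℝ)) = ∑ i, Z i ω := by
    intro ω
    rw [Finset.card_filter]
    push_cast
    refine Finset.sum_congr rfl fun i _ => ?_
    simp [Z, A, Set.indicator_apply]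
  simp_rw [hcard]
  have hexp : ∀ ω, ((∑ i, Z i ω) / k - D) ^ 2
      = (∑ i, ∑ j, Z i ω * Z j ω) / k ^ 2 - (2 * D / k) * (∑ i, Z i ω) + D ^ 2 := by
    intro ω
    rw [← Finset.sum_mul_sum]
    field_simp
    ring
  simp_rw [hexp]
  have i1 : Integrable (fun ω => ∑ i, ∑ j, Z i ω * Z j ω) P :=
    integrable_finsetSum _ fun i _ => integrable_finsetSum _ fun j _ => hZZint i j
  have i2 : Integrable (fun ω => ∑ i, Z i ω) P := integrable_finsetSum _ fun i _ => hZint i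
  have i3 : Integrable (fun ω => (∑ i, ∑ j, Z i ω * Z j ω) / (k:ℝ) ^ 2
      - (2 * D / k) * (∑ i, Z i ω)) P := (i1.div_const _).sub (i2.const_mul _)
  rw [integral_add i3 (integrable_const _),
    integral_sub (i1.div_const _) (i2.const_mul _), integral_div, integral_const_mul,
    integral_finsetSum _ (fun i _ => integrable_finsetSum _ fun j _ => hZZint i j),
    integral_finsetSum _ (fun i _ => hZint i)]
  simp_rw [integral_finsetSum _ (fun j _ => hZZint _ j), hZZE, hZE]
  have hb : ∑ i, ∑ j, P.real (A i ∩ A j) ≤ k + k ^ 2 * D' ^ 2 := by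
    have : ∀ i j, P.real (A i ∩ A j) ≤ (if i = j then 1 else 0) + D' ^ 2 := by
      intro i j
      split_ifs with h
      · have : P.real (A i ∩ A j) ≤ 1 := measureReal_le_one
        nlinarith [sq_nonneg D']
      · simpa using hPAA i j h
    calc _ ≤ ∑ i : Fin k, ∑ j : Fin k, ((if i = j then (1:ℝ) else 0) + D' ^ 2) :=
          Finset.sum_le_sum fun i _ => Finset.sum_le_sum fun j _ => this i j
      _ = _ := by simp [Finset.sum_add_distrib]; ring
  have hb2 : (∑ i, ∑ j, P.real (A i ∩ A j)) / (k:ℝ) ^ 2 ≤ 1 / k + D' ^ 2 := by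
    rw [div_le_iff₀ (by positivity)]
    refine hb.trans (le_of_eq ?_)
    field_simp
  have e1 : 2 * D / (k:ℝ) * ∑ i : Fin k, D = 2 * D ^ 2 := by
    simp; field_simp
  rw [e1]
  simp only [integral_const, probReal_univ, one_smul]
  have : (1 + 2 * (C₀ * x)) / (k:ℝ) = 1 / k + 2 * (C₀ * x / k) := by ring
  rw [this]
  linarith
end

section
/- Fix x > 0. For each integer k ≥ 2 let ξ_1, …, ξ_k be i.i.d. random variables uniformly distributed on [0,1], and let N_k denote the number of indices i ∈ {1,…,k} such that no other sample point ξ_j (j ≠ i) lies in the half-open interval (ξ_i, ξ_i + x/k]. Then N_k/k converges to e^{−x} in L², i.e. E[(N_k/k − e^{−x})²] → 0 as k → ∞. -/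
open MeasureTheory ProbabilityTheory Filter

lemma aux_slice {Ω α β : Type*} [MeasurableSpace Ω] [MeasurableSpace α] [MeasurableSpace β]
    (P : Measure Ω) [IsProbabilityMeasure P] (X : Ω → α) (Y : Ω → β) (hX : Measurable X)
    (hY : Measurable Y) (h : IndepFun X Y P) (T : Set (α × β)) (hT : MeasurableSet T) :
    P {ω | (X ω, Y ω) ∈ T} = ∫⁻ a, P {ω | (a, Y ω) ∈ T} ∂(P.map X) := by
  have h1 := (indepFun_iff_map_prod_eq_prod_map_map hX.aemeasurable hY.aemeasurable).1 h
  have : IsProbabilityMeasure (P.map Y) := Measure.isProbabilityMeasure_map hY.aemeasurable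
  have h2 : P {ω | (X ω, Y ω) ∈ T} = (P.map (fun ω => (X ω, Y ω))) T := by
    rw [Measure.map_apply (hX.prodMk hY) hT]; rfl
  rw [h2, h1, Measure.prod_apply hT]
  refine lintegral_congr fun a => ?_
  rw [Measure.map_apply hY (measurable_prodMk_left hT)]; rfl

lemma aux_void {Ω : Type*} [MeasurableSpace Ω] (P : Measure Ω) [IsProbabilityMeasure P] {k : ℕ}
    (ξ : Fin k → Ω → ℝ) (hmeas : ∀ i, Measurable (ξ i)) (hindep : iIndepFun ξ P)
    (hlaw : ∀ i, Measure.map (ξ i) P = volume.restrict (Set.Icc (0 : ℝ) 1))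
    (S : Finset (Fin k)) (U : Set ℝ) (hU : MeasurableSet U) :
    P {ω | ∀ j ∈ S, ξ j ω ∉ U} = (1 - volume (U ∩ Set.Icc 0 1)) ^ S.card := by
  have h := hindep.measure_inter_preimage_eq_mul S (sets := fun _ => Uᶜ) (fun _ _ => hU.compl)
  have e : {ω | ∀ j ∈ S, ξ j ω ∉ U} = ⋂ i ∈ S, ξ i ⁻¹' Uᶜ := by ext; simp
  rw [e, h, Finset.prod_congr rfl (g := fun _ => 1 - volume (U ∩ Set.Icc 0 1)),
    Finset.prod_const]
  intro i _
  have hp : IsProbabilityMeasure (P.map (ξ i)) :=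
    Measure.isProbabilityMeasure_map (hmeas i).aemeasurable
  rw [← Measure.map_apply (hmeas i) hU.compl, prob_compl_eq_one_sub hU, hlaw,
    Measure.restrict_apply hU]

lemma aux_meas {Ω : Type*} [MeasurableSpace Ω] {k : ℕ}
    (ξ : Fin k → Ω → ℝ) (hmeas : ∀ i, Measurable (ξ i)) (δ : ℝ) (i : Fin k) :
    MeasurableSet {ω | ∀ j, j ≠ i → ξ j ω ∉ Set.Ioc (ξ i ω) (ξ i ω + δ)} := by
  simp only [Set.ofPred_forall]
  refine MeasurableSet.iInter fun j => MeasurableSet.iInter fun _ => ?_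
  exact ((measurableSet_lt (hmeas i) (hmeas j)).inter
    (measurableSet_le (hmeas j) ((hmeas i).add_const δ))).compl

lemma aux_lower {Ω : Type*} [MeasurableSpace Ω] (P : Measure Ω) [IsProbabilityMeasure P] {k : ℕ}
    (ξ : Fin k → Ω → ℝ) (hmeas : ∀ i, Measurable (ξ i)) (hindep : iIndepFun ξ P)
    (hlaw : ∀ i, Measure.map (ξ i) P = volume.restrict (Set.Icc (0 : ℝ) 1))
    (δ : ℝ) (i : Fin k) :
    (1 - ENNReal.ofReal δ) ^ (k - 1) ≤
      P {ω | ∀ j, j ≠ i → ξ j ω ∉ Set.Ioc (ξ i ω) (ξ i ω + δ)} := by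
  set S : Finset (Fin k) := Finset.univ.erase i with hS
  have hI : IndepFun (ξ i) (fun ω (j : S) => ξ j ω) P := (hindep.indepFun_finset {i} S (by simp [hS]) hmeas).comp
    (φ := fun f : (({i} : Finset (Fin k)) → ℝ) => f ⟨i, by simp⟩) (ψ := id)
    (measurable_pi_apply _) measurable_id
  have hY : Measurable (fun ω (j : S) => ξ j ω) := measurable_pi_iff.2 fun j => hmeas j
  have hT : MeasurableSet {p : ℝ × (S → ℝ) | ∀ j : S, p.2 j ∉ Set.Ioc p.1 (p.1 + δ)} := by
    simp only [Set.ofPred_forall]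
    refine MeasurableSet.iInter fun j => ?_
    have hj : Measurable fun p : ℝ × (S → ℝ) => p.2 j := by fun_prop
    exact ((measurableSet_lt measurable_fst hj).inter
      (measurableSet_le hj (measurable_fst.add_const δ))).compl
  have h := aux_slice P (ξ i) (fun ω (j : S) => ξ j ω) (hmeas i) hY hI _ hT
  have e : {ω | ∀ j, j ≠ i → ξ j ω ∉ Set.Ioc (ξ i ω) (ξ i ω + δ)} =
      {ω | (ξ i ω, fun (j : S) => ξ j ω) ∈
        {p : ℝ × (S → ℝ) | ∀ j : S, p.2 j ∉ Set.Ioc p.1 (p.1 + δ)}} := by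
    ext ω; simp [hS]
  rw [e, h]
  have hp : IsProbabilityMeasure (P.map (ξ i)) :=
    Measure.isProbabilityMeasure_map (hmeas i).aemeasurable
  calc (1 - ENNReal.ofReal δ) ^ (k - 1)
      = ∫⁻ a, (1 - ENNReal.ofReal δ) ^ (k - 1) ∂(P.map (ξ i)) := by simp
    _ ≤ _ := by
      refine lintegral_mono fun a => ?_
      have h2 := aux_void P ξ hmeas hindep hlaw S (Set.Ioc a (a + δ)) measurableSet_Ioc
      have e2 : {ω | (a, fun (j : S) => ξ j ω) ∈
        {p : ℝ × (S → ℝ) | ∀ j : S, p.2 j ∉ Set.Ioc p.1 (p.1 + δ)}} =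
        {ω | ∀ j ∈ S, ξ j ω ∉ Set.Ioc a (a + δ)} := by
        ext ω; simp
      rw [e2, h2]
      have hc : S.card = k - 1 := by simp [hS]
      rw [hc]
      gcongr
      calc _ ≤ volume (Set.Ioc a (a + δ)) := measure_mono Set.inter_subset_left
        _ = _ := by simp

lemma aux_close {Ω : Type*} [MeasurableSpace Ω] (P : Measure Ω) [IsProbabilityMeasure P] {k : ℕ}
    (ξ : Fin k → Ω → ℝ) (hmeas : ∀ i, Measurable (ξ i)) (hindep : iIndepFun ξ P)
    (hlaw : ∀ i, Measure.map (ξ i) P = volume.restrict (Set.Icc (0 : ℝ) 1))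
    (δ : ℝ) (i j : Fin k) (hij : i ≠ j) :
    P {ω | |ξ j ω - ξ i ω| < δ} ≤ ENNReal.ofReal (2 * δ) := by
  have hT : MeasurableSet {p : ℝ × ℝ | |p.2 - p.1| < δ} :=
    measurableSet_lt (by fun_prop) (by fun_prop)
  have h := aux_slice P (ξ i) (ξ j) (hmeas i) (hmeas j) (hindep.indepFun hij) _ hT
  have hp : IsProbabilityMeasure (P.map (ξ i)) :=
    Measure.isProbabilityMeasure_map (hmeas i).aemeasurable
  calc _ = _ := h
    _ ≤ ∫⁻ a, ENNReal.ofReal (2 * δ) ∂(P.map (ξ i)) := by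
      refine lintegral_mono fun a => ?_
      calc P {ω | (a, ξ j ω) ∈ {p : ℝ × ℝ | |p.2 - p.1| < δ}}
          = P.map (ξ j) (Metric.ball a δ) := by
            rw [Measure.map_apply (hmeas j) measurableSet_ball]; rfl
        _ ≤ volume (Metric.ball a δ) := by
            rw [hlaw]; exact Measure.restrict_apply_le _ _
        _ = _ := by rw [Real.volume_ball]
    _ = _ := by simp

lemma aux_edge {Ω : Type*} [MeasurableSpace Ω] (P : Measure Ω) {k : ℕ}
    (ξ : Fin k → Ω → ℝ) (hmeas : ∀ i, Measurable (ξ i))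
    (hlaw : ∀ i, Measure.map (ξ i) P = volume.restrict (Set.Icc (0 : ℝ) 1))
    (δ : ℝ) (hδ : δ ≤ 1) (i : Fin k) :
    P {ω | ξ i ω ∉ Set.Icc 0 (1 - δ)} ≤ ENNReal.ofReal δ := by
  have : P {ω | ξ i ω ∉ Set.Icc 0 (1 - δ)} = P.map (ξ i) (Set.Icc 0 (1 - δ))ᶜ := by
    rw [Measure.map_apply (hmeas i) measurableSet_Icc.compl]; rfl
  rw [this, hlaw, Measure.restrict_apply measurableSet_Icc.compl]
  calc _ ≤ volume (Set.Ioc (1 - δ) 1) := by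
        refine measure_mono ?_
        rintro y ⟨h1, h2, h3⟩
        refine ⟨?_, h3⟩
        by_contra hc
        exact h1 ⟨h2, not_lt.1 hc⟩
    _ = _ := by simp

lemma aux_upper {Ω : Type*} [MeasurableSpace Ω] (P : Measure Ω) [IsProbabilityMeasure P] {k : ℕ}
    (ξ : Fin k → Ω → ℝ) (hmeas : ∀ i, Measurable (ξ i)) (hindep : iIndepFun ξ P)
    (hlaw : ∀ i, Measure.map (ξ i) P = volume.restrict (Set.Icc (0 : ℝ) 1))
    (δ : ℝ) (hδ0 : 0 ≤ δ) (hδ : δ ≤ 1) (i i' : Fin k) (hii : i ≠ i') :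
    P ({ω | ∀ j, j ≠ i → ξ j ω ∉ Set.Ioc (ξ i ω) (ξ i ω + δ)} ∩
       {ω | ∀ j, j ≠ i' → ξ j ω ∉ Set.Ioc (ξ i' ω) (ξ i' ω + δ)}) ≤
      (1 - ENNReal.ofReal (2 * δ)) ^ (k - 2) + ENNReal.ofReal (4 * δ) := by
  set S : Finset (Fin k) := (Finset.univ.erase i).erase i' with hS
  have hI : IndepFun (fun ω => (ξ i ω, ξ i' ω)) (fun ω (j : S) => ξ j ω) P :=
    (hindep.indepFun_finset {i, i'} S (by simp [hS, Finset.disjoint_left]) hmeas).comp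
    (φ := fun f : (({i, i'} : Finset (Fin k)) → ℝ) => (f ⟨i, by simp⟩, f ⟨i', by simp⟩)) (ψ := id)
    ((measurable_pi_apply _).prodMk (measurable_pi_apply _)) measurable_id
  have hY : Measurable (fun ω (j : S) => ξ j ω) := measurable_pi_iff.2 fun j => hmeas j
  set G : Set (ℝ × ℝ) := {a | a.1 ∈ Set.Icc 0 (1 - δ) ∧ a.2 ∈ Set.Icc 0 (1 - δ) ∧
    δ ≤ |a.2 - a.1|} with hG
  have hGm : MeasurableSet G :=
    (measurableSet_Icc.preimage measurable_fst).inter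
      ((measurableSet_Icc.preimage measurable_snd).inter
        (measurableSet_le (f := fun _ : ℝ × ℝ => δ) (g := fun a : ℝ × ℝ => |a.2 - a.1|)
          (by fun_prop) (by fun_prop)))
  set T : Set ((ℝ × ℝ) × (S → ℝ)) := {p | p.1 ∈ G ∧ ∀ j : S,
    p.2 j ∉ Set.Ioc p.1.1 (p.1.1 + δ) ∪ Set.Ioc p.1.2 (p.1.2 + δ)} with hTd
  have hT : MeasurableSet T := by
    suffices hT2 : MeasurableSet {p : (ℝ × ℝ) × (S → ℝ) | ∀ j : S,
        p.2 j ∉ Set.Ioc p.1.1 (p.1.1 + δ) ∪ Set.Ioc p.1.2 (p.1.2 + δ)} from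
      (hGm.preimage measurable_fst).inter hT2
    simp only [Set.ofPred_forall]
    refine MeasurableSet.iInter fun j => ?_
    have hj : Measurable fun p : (ℝ × ℝ) × (S → ℝ) => p.2 j := by fun_prop
    have h1 : Measurable fun p : (ℝ × ℝ) × (S → ℝ) => p.1.1 := by fun_prop
    have h2 : Measurable fun p : (ℝ × ℝ) × (S → ℝ) => p.1.2 := by fun_prop
    exact (((measurableSet_lt h1 hj).inter (measurableSet_le hj (h1.add_const δ))).union
      ((measurableSet_lt h2 hj).inter (measurableSet_le hj (h2.add_const δ)))).compl
  have hX : Measurable fun ω => (ξ i ω, ξ i' ω) := (hmeas i).prodMk (hmeas i')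
  have h := aux_slice P (fun ω => (ξ i ω, ξ i' ω)) (fun ω (j : S) => ξ j ω) hX hY hI _ hT
  have hp : IsProbabilityMeasure (P.map (fun ω => (ξ i ω, ξ i' ω))) :=
    Measure.isProbabilityMeasure_map hX.aemeasurable
  have hmain : P {ω | ((ξ i ω, ξ i' ω), fun (j : S) => ξ j ω) ∈ T} ≤
      (1 - ENNReal.ofReal (2 * δ)) ^ (k - 2) := by
    rw [h]
    calc _ ≤ ∫⁻ a, (1 - ENNReal.ofReal (2 * δ)) ^ (k - 2) ∂(P.map (fun ω => (ξ i ω, ξ i' ω))) := by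
          refine lintegral_mono fun a => ?_
          by_cases ha : a ∈ G
          · have h2 := aux_void P ξ hmeas hindep hlaw S
              (Set.Ioc a.1 (a.1 + δ) ∪ Set.Ioc a.2 (a.2 + δ))
              (measurableSet_Ioc.union measurableSet_Ioc)
            have e2 : {ω | (a, fun (j : S) => ξ j ω) ∈ T} =
              {ω | ∀ j ∈ S, ξ j ω ∉ Set.Ioc a.1 (a.1 + δ) ∪ Set.Ioc a.2 (a.2 + δ)} := by
              ext ω; simp [hTd, ha]
            simp only [e2]
            rw [h2]
            have hc : S.card = k - 2 := by
              rw [hS, Finset.card_erase_of_mem (by simp [hii.symm]),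
                Finset.card_erase_of_mem (by simp)]
              simp; omega
            rw [hc]
            have hv : volume ((Set.Ioc a.1 (a.1 + δ) ∪ Set.Ioc a.2 (a.2 + δ)) ∩ Set.Icc 0 1) =
                ENNReal.ofReal (2 * δ) := by
              obtain ⟨⟨g1, g2⟩, ⟨g3, g4⟩, g5⟩ := ha
              rw [Set.inter_eq_left.2, measure_union _ measurableSet_Ioc, Real.volume_Ioc,
                Real.volume_Ioc, ← ENNReal.ofReal_add (by linarith) (by linarith)]
              · congr 1; ring
              · rw [Set.disjoint_left]
                rintro y ⟨y1, y2⟩ ⟨y3, y4⟩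
                rcases le_abs.1 g5 with g | g <;> linarith
              · rintro y (⟨y1, y2⟩ | ⟨y1, y2⟩) <;> constructor <;> linarith
            rw [hv]
          · have e2 : {ω | (a, fun (j : S) => ξ j ω) ∈ T} = ∅ := by
              ext ω; simp [hTd, ha]
            simp only [e2]; simp
      _ = _ := by simp
  have hsub : ({ω | ∀ j, j ≠ i → ξ j ω ∉ Set.Ioc (ξ i ω) (ξ i ω + δ)} ∩
       {ω | ∀ j, j ≠ i' → ξ j ω ∉ Set.Ioc (ξ i' ω) (ξ i' ω + δ)}) ⊆
      {ω | ((ξ i ω, ξ i' ω), fun (j : S) => ξ j ω) ∈ T} ∪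
      (({ω | ξ i ω ∉ Set.Icc 0 (1 - δ)} ∪ {ω | ξ i' ω ∉ Set.Icc 0 (1 - δ)}) ∪
        {ω | |ξ i' ω - ξ i ω| < δ}) := by
    rintro ω ⟨h1, h2⟩
    by_cases hg : (ξ i ω, ξ i' ω) ∈ G
    · left
      refine ⟨hg, fun j => ?_⟩
      have hj := j.2
      simp only [hS, Finset.mem_erase] at hj
      rintro (h3 | h3)
      · exact h1 j hj.2.1 h3
      · exact h2 j hj.1 h3
    · right
      by_contra hc
      simp only [Set.mem_union, Set.mem_ofPred_eq, not_or, not_not, not_lt] at hc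
      exact hg ⟨hc.1.1, hc.1.2, hc.2⟩
  refine (measure_mono hsub).trans ((measure_union_le _ _).trans (add_le_add hmain ?_))
  have e4 : ENNReal.ofReal (4 * δ) =
      ENNReal.ofReal δ + ENNReal.ofReal δ + ENNReal.ofReal (2 * δ) := by
    rw [← ENNReal.ofReal_add hδ0 hδ0, ← ENNReal.ofReal_add (by linarith) (by linarith)]
    congr 1; ring
  rw [e4]
  exact (measure_union_le _ _).trans (add_le_add ((measure_union_le _ _).trans (add_le_add
    (aux_edge P ξ hmeas hlaw δ hδ i) (aux_edge P ξ hmeas hlaw δ hδ i')))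
    (aux_close P ξ hmeas hindep hlaw δ i i' hii))

open Classical in
lemma aux_bound {Ω : Type*} [MeasurableSpace Ω] (P : Measure Ω) [IsProbabilityMeasure P] {k : ℕ}
    (hk : 0 < k) (A : Fin k → Set Ω) (hA : ∀ i, MeasurableSet (A i)) (e l u : ℝ) (he : 0 ≤ e)
    (hu0 : 0 ≤ u)
    (hl : ∀ i, l ≤ P.real (A i)) (hu : ∀ i j, i ≠ j → P.real (A i ∩ A j) ≤ u) :
    ∫ ω, (((Finset.univ.filter fun i : Fin k => ω ∈ A i).card : ℝ) / k - e) ^ 2 ∂P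
      ≤ 1 / k + u - 2 * e * l + e ^ 2 := by
  have hk' : (0 : ℝ) < k := by exact_mod_cast hk
  have hf : ∀ ω, (((Finset.univ.filter fun i : Fin k => ω ∈ A i).card : ℝ) / k - e) ^ 2 =
      (1 / (k : ℝ) ^ 2) * (∑ i, ∑ j, (A i ∩ A j).indicator (fun _ => (1 : ℝ)) ω)
      - (2 * e / k) * (∑ i, (A i).indicator (fun _ => (1 : ℝ)) ω) + e ^ 2 := by
    intro ω
    have h1 : ((Finset.univ.filter fun i : Fin k => ω ∈ A i).card : ℝ) =
        ∑ i, (A i).indicator (fun _ => (1 : ℝ)) ω := by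
      simp [Set.indicator_apply]
    have h2 : (∑ i, ∑ j, (A i ∩ A j).indicator (fun _ => (1 : ℝ)) ω) =
        (∑ i, (A i).indicator (fun _ => (1 : ℝ)) ω) ^ 2 := by
      rw [sq, Finset.sum_mul_sum]
      refine Finset.sum_congr rfl fun i _ => Finset.sum_congr rfl fun j _ => ?_
      by_cases h3 : ω ∈ A i <;> by_cases h4 : ω ∈ A j <;> simp [h3, h4]
    rw [h1, h2]
    field_simp
    ring
  have hint : ∀ s : Set Ω, MeasurableSet s → Integrable (s.indicator (fun _ => (1 : ℝ))) P :=
    fun s hs => (integrable_const 1).indicator hs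
  have hI1 : Integrable (fun ω => ∑ i, ∑ j, (A i ∩ A j).indicator (fun _ => (1 : ℝ)) ω) P :=
    integrable_finsetSum _ fun i _ => integrable_finsetSum _ fun j _ =>
      hint _ ((hA i).inter (hA j))
  have hI2 : Integrable (fun ω => ∑ i, (A i).indicator (fun _ => (1 : ℝ)) ω) P :=
    integrable_finsetSum _ fun i _ => hint _ (hA i)
  have hv1 : ∫ ω, ∑ i, ∑ j, (A i ∩ A j).indicator (fun _ => (1 : ℝ)) ω ∂P =
      ∑ i, ∑ j, P.real (A i ∩ A j) := by
    rw [integral_finsetSum _ fun i _ => integrable_finsetSum _ fun j _ =>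
      hint _ ((hA i).inter (hA j))]
    refine Finset.sum_congr rfl fun i _ => ?_
    rw [integral_finsetSum _ fun j _ => hint _ ((hA i).inter (hA j))]
    refine Finset.sum_congr rfl fun j _ => ?_
    rw [integral_indicator_const _ ((hA i).inter (hA j))]; simp
  have hv2 : ∫ ω, ∑ i, (A i).indicator (fun _ => (1 : ℝ)) ω ∂P = ∑ i, P.real (A i) := by
    rw [integral_finsetSum _ fun i _ => hint _ (hA i)]
    refine Finset.sum_congr rfl fun i _ => ?_
    rw [integral_indicator_const _ (hA i)]; simp
  simp_rw [hf]
  have hI3 : Integrable (fun ω =>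
      (1 / (k : ℝ) ^ 2) * (∑ i, ∑ j, (A i ∩ A j).indicator (fun _ => (1 : ℝ)) ω)
      - (2 * e / k) * (∑ i, (A i).indicator (fun _ => (1 : ℝ)) ω)) P :=
    (hI1.const_mul _).sub (hI2.const_mul _)
  rw [integral_add hI3 (integrable_const _),
    integral_sub (hI1.const_mul _) (hI2.const_mul _), integral_const_mul, integral_const_mul,
    hv1, hv2]
  have b1 : ∑ i, ∑ j, P.real (A i ∩ A j) ≤ k + k ^ 2 * u := by
    calc _ ≤ ∑ i : Fin k, ∑ j : Fin k, ((if i = j then (1 : ℝ) else 0) + u) := by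
          refine Finset.sum_le_sum fun i _ => Finset.sum_le_sum fun j _ => ?_
          by_cases h : i = j
          · simp only [h, if_true]
            linarith [measureReal_le_one (μ := P) (s := A j ∩ A j)]
          · simp only [h, if_false]; linarith [hu i j h]
      _ = _ := by
          simp [Finset.sum_add_distrib]; ring
  have b2 : k * l ≤ ∑ i, P.real (A i) := by
    calc k * l = ∑ i : Fin k, l := by simp
      _ ≤ _ := Finset.sum_le_sum fun i _ => hl i
  have c1 : 1 / (k : ℝ) ^ 2 * ∑ i, ∑ j, P.real (A i ∩ A j) ≤ 1 / k + u := by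
    calc _ ≤ 1 / (k : ℝ) ^ 2 * (k + k ^ 2 * u) := by gcongr
      _ = _ := by field_simp
  have c2 : 2 * e * l ≤ 2 * e / k * ∑ i, P.real (A i) := by
    calc 2 * e * l = 2 * e / k * (k * l) := by field_simp
      _ ≤ _ := by gcongr
  simp
  simp at c1
  linarith

lemma aux_lim (x : ℝ) (m : ℕ) :
    Tendsto (fun k : ℕ => (1 - x / k) ^ (k - m)) atTop (nhds (Real.exp (-x))) := by
  have h := Real.tendsto_one_add_div_pow_exp (-x)
  have h0 : Tendsto (fun k : ℕ => 1 - x / (k : ℝ)) atTop (nhds 1) := by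
    simpa using (tendsto_const_div_atTop_nhds_zero_nat x).const_sub 1
  have h1 := h.div (h0.pow m) (by simp)
  simp only [one_pow, div_one] at h1
  refine h1.congr' ?_
  filter_upwards [eventually_ge_atTop m, h0.eventually_ne one_ne_zero] with k hk hne
  have : (1 + -x / (k : ℝ)) = 1 - x / k := by ring
  simp only [Pi.div_apply, this]
  rw [pow_sub₀ _ hne hk]; rfl

/-- Poisson limit for nearest-neighbor spacings of i.i.d. uniform points on `[0,1]`:
the proportion of the `k` points with no other point in the interval of length `x/k` to their
right converges to `e^{-x}` in `L²` as `k → ∞`. -/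
theorem uniform_spacing_count_tendsto_exp (x : ℝ) (hx : 0 < x)
    (Ω : ℕ → Type*) (mΩ : ∀ k, MeasurableSpace (Ω k)) (P : ∀ k, Measure (Ω k))
    (hP : ∀ k, IsProbabilityMeasure (P k))
    (ξ : ∀ k : ℕ, Fin k → Ω k → ℝ) (hmeas : ∀ k i, Measurable (ξ k i))
    (hindep : ∀ k, iIndepFun (ξ k) (P k))
    (hlaw : ∀ k i, Measure.map (ξ k i) (P k) = volume.restrict (Set.Icc (0 : ℝ) 1)) :
    Tendsto (fun k : ℕ => ∫ ω, (((Finset.univ.filter fun i : Fin k =>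
        ∀ j, j ≠ i → ξ k j ω ∉ Set.Ioc (ξ k i ω) (ξ k i ω + x / k)).card : ℝ) / k
        - Real.exp (-x)) ^ 2 ∂(P k)) atTop (nhds 0) := by
  have hδ0 : Tendsto (fun k : ℕ => x / (k : ℝ)) atTop (nhds 0) :=
    tendsto_const_div_atTop_nhds_zero_nat x
  have hlim : Tendsto (fun k : ℕ => 1 / (k : ℝ) + ((1 - 2 * x / k) ^ (k - 2) + 4 * (x / k))
      - 2 * Real.exp (-x) * (1 - x / k) ^ (k - 1) + Real.exp (-x) ^ 2) atTop (nhds 0) := by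
    have := (((tendsto_const_div_atTop_nhds_zero_nat (1 : ℝ)).add
      ((aux_lim (2 * x) 2).add (hδ0.const_mul 4))).sub
      ((aux_lim x 1).const_mul (2 * Real.exp (-x)))).add_const (Real.exp (-x) ^ 2)
    convert this using 2
    have : Real.exp (-(2 * x)) = Real.exp (-x) ^ 2 := by
      rw [← Real.exp_nat_mul]; congr 1; push_cast; ring
    rw [this]; ring
  refine tendsto_of_tendsto_of_tendsto_of_le_of_le' tendsto_const_nhds hlim
    (Eventually.of_forall fun k => integral_nonneg fun ω => sq_nonneg _) ?_
  filter_upwards [eventually_gt_atTop 0, hδ0.eventually_le_const (u := 1 / 2) (by norm_num)]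
    with k hk hδ
  have hP' := hP k
  have hk' : (0 : ℝ) < k := by exact_mod_cast hk
  have hd : 0 ≤ x / k := by positivity
  have e2 : 2 * x / (k : ℝ) = 2 * (x / k) := by ring
  have hn1 : 0 ≤ (1 - 2 * (x / (k : ℝ))) := by linarith
  rw [e2]
  have hb := aux_bound (P k) hk
    (fun i => {ω | ∀ j, j ≠ i → ξ k j ω ∉ Set.Ioc (ξ k i ω) (ξ k i ω + x / k)})
    (aux_meas (ξ k) (hmeas k) (x / k)) (Real.exp (-x)) ((1 - x / k) ^ (k - 1))
    ((1 - 2 * (x / k)) ^ (k - 2) + 4 * (x / k)) (Real.exp_pos _).le (by positivity) ?_ ?_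
  · refine le_trans (le_of_eq ?_) hb
    refine integral_congr_ae (Eventually.of_forall fun ω => ?_)
    simp only [Set.mem_ofPred_eq]
  · intro i
    have h := aux_lower (P k) (ξ k) (hmeas k) (hindep k) (hlaw k) (x / k) i
    rw [measureReal_def, ← ENNReal.ofReal_le_iff_le_toReal (measure_ne_top _ _),
      ENNReal.ofReal_pow (by linarith), ENNReal.ofReal_sub _ hd, ENNReal.ofReal_one]
    exact h
  · intro i j hij
    have h := aux_upper (P k) (ξ k) (hmeas k) (hindep k) (hlaw k) (x / k) hd (by linarith) i j hij
    refine ENNReal.toReal_le_of_le_ofReal (by positivity) ?_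
    rw [ENNReal.ofReal_add (by positivity) (by positivity), ENNReal.ofReal_pow hn1,
      ENNReal.ofReal_sub _ (by positivity), ENNReal.ofReal_one]
    exact h
end

section
/- Fix integers k, k' ≥ 0 and a real C₀ > 0. There exists a constant C = C(k, k', C₀) such that for every integer N ≥ 1 and every family of i.i.d. random pairs (X_j, Y_j), j = 1, …, N, with values in {0,1} × {0,1} and with P(X_1 = 1) ≤ C₀/N and P(Y_1 = 1) ≤ C₀/N, setting S = X_1 + ⋯ + X_N and T = Y_1 + ⋯ + Y_N, one has |E[S^k T^{k'}] − E[S^k]·E[T^{k'}]| ≤ C·( N·E[X_1]·E[Y_1] + N·E[X_1 Y_1] ). -/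
open MeasureTheory ProbabilityTheory Filter

noncomputable def jmx (z : Bool × Bool) : ℝ := if z.1 then (1 : ℝ) else 0
noncomputable def jmy (z : Bool × Bool) : ℝ := if z.2 then (1 : ℝ) else 0

lemma jmx_nonneg (z) : 0 ≤ jmx z := by unfold jmx; split_ifs <;> norm_num
lemma jmy_nonneg (z) : 0 ≤ jmy z := by unfold jmy; split_ifs <;> norm_num
lemma jmx_idem (z) : jmx z * jmx z = jmx z := by unfold jmx; split_ifs <;> norm_num
lemma jmy_idem (z) : jmy z * jmy z = jmy z := by unfold jmy; split_ifs <;> norm_num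

noncomputable def jmh (z : Bool × Bool) : ℝ := Real.exp (jmx z + jmy z)

lemma jmh_le (z) : jmh z ≤ Real.exp 2 := by
  unfold jmh jmx jmy
  apply Real.exp_le_exp.2
  split_ifs <;> norm_num

lemma jmh_le' (z) : jmh z ≤ 1 + Real.exp 2 * (jmx z + jmy z) := by
  have h1 : Real.exp 1 ≤ Real.exp 2 := Real.exp_le_exp.2 (by norm_num)
  have h2 := Real.exp_pos 2
  unfold jmh jmx jmy
  split_ifs
  · norm_num; linarith
  · norm_num; linarith
  · norm_num; linarith
  · norm_num

section
variable {N : ℕ} {Ω : Type} [MeasurableSpace Ω] {P : Measure Ω} [IsProbabilityMeasure P]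
  {Z : Fin N → Ω → Bool × Bool}

lemma jm_int (hZ : ∀ j, Measurable (Z j)) (G : (Fin N → Bool × Bool) → ℝ) :
    Integrable (fun ω => G (fun j => Z j ω)) P := by
  have hm : Measurable (fun ω j => Z j ω) := measurable_pi_lambda _ hZ
  exact (Integrable.of_finite (f := G) (μ := P.map (fun ω j => Z j ω))).comp_measurable hm

lemma jm_int1 (hZ : ∀ j, Measurable (Z j)) (j : Fin N) (G : Bool × Bool → ℝ) :
    Integrable (fun ω => G (Z j ω)) P := jm_int hZ (fun z => G (z j))

lemma jm_same (hZ : ∀ j, Measurable (Z j))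
    (hid : ∀ j j' : Fin N, Measure.map (Z j) P = Measure.map (Z j') P) (i j : Fin N)
    (G : Bool × Bool → ℝ) : ∫ ω, G (Z i ω) ∂P = ∫ ω, G (Z j ω) ∂P := by
  have hG : ∀ μ : Measure (Bool × Bool), AEStronglyMeasurable G μ :=
    fun μ => (measurable_of_finite G).aestronglyMeasurable
  rw [← integral_map (hZ i).aemeasurable (hG _), ← integral_map (hZ j).aemeasurable (hG _),
    hid i j]

lemma jm_prod (hZ : ∀ j, Measurable (Z j)) (hind : iIndepFun Z P)
    (G : Fin N → Bool × Bool → ℝ) :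
    ∫ ω, ∏ i, G i (Z i ω) ∂P = ∏ i, ∫ ω, G i (Z i ω) ∂P :=
  hind.integral_fun_prod_comp (fun i => (hZ i).aemeasurable)
    (fun i => (measurable_of_finite (G i)).aestronglyMeasurable)

lemma jm_mom (hZ : ∀ j, Measurable (Z j)) (hind : iIndepFun Z P)
    (hid : ∀ j j' : Fin N, Measure.map (Z j) P = Measure.map (Z j') P) (C₀ : ℝ) (hC₀ : 0 < C₀)
    (j : Fin N)
    (hx : ∫ ω, jmx (Z j ω) ∂P ≤ C₀ / N) (hy : ∫ ω, jmy (Z j ω) ∂P ≤ C₀ / N)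
    (u : Bool × Bool → ℝ) (hu : ∀ z, 0 ≤ u z) (a b : ℕ) (i : Fin N) :
    ∫ ω, u (Z i ω) * ((∑ l, jmx (Z l ω)) ^ a * (∑ l, jmy (Z l ω)) ^ b) ∂P ≤
      (a.factorial * b.factorial * Real.exp 2 * Real.exp (2 * Real.exp 2 * C₀)) *
        ∫ ω, u (Z j ω) ∂P := by
  have hN : 0 < (N : ℝ) := by exact_mod_cast (Nat.zero_le _).trans_lt i.2
  have key : ∀ (s : ℝ) (n : ℕ), 0 ≤ s → s ^ n ≤ n.factorial * Real.exp s := by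
    intro s n hs
    have := Real.pow_div_factorial_le_exp s hs n
    rwa [div_le_iff₀' (by positivity)] at this
  have hh : ∀ l, ∫ ω, jmh (Z l ω) ∂P ≤ Real.exp (2 * Real.exp 2 * C₀ / N) := by
    intro l
    rw [jm_same hZ hid l j]
    calc ∫ ω, jmh (Z j ω) ∂P ≤ ∫ ω, (1 + Real.exp 2 * (jmx (Z j ω) + jmy (Z j ω))) ∂P := by
          refine integral_mono (jm_int1 hZ j jmh)
            (jm_int1 hZ j (fun z => 1 + Real.exp 2 * (jmx z + jmy z))) (fun ω => jmh_le' _)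
      _ = 1 + Real.exp 2 * (∫ ω, jmx (Z j ω) ∂P + ∫ ω, jmy (Z j ω) ∂P) := by
          rw [integral_add (integrable_const _)
            (jm_int1 hZ j (fun z => Real.exp 2 * (jmx z + jmy z))), integral_const_mul,
            integral_add (jm_int1 hZ j jmx) (jm_int1 hZ j jmy)]
          simp
      _ ≤ 1 + Real.exp 2 * (C₀ / N + C₀ / N) := by gcongr
      _ = 2 * Real.exp 2 * C₀ / N + 1 := by ring
      _ ≤ _ := Real.add_one_le_exp _
  have hprod : ∫ ω, u (Z i ω) * ∏ l, jmh (Z l ω) ∂P ≤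
      Real.exp 2 * Real.exp (2 * Real.exp 2 * C₀) * ∫ ω, u (Z j ω) ∂P := by
    have e1 : ∀ ω, u (Z i ω) * ∏ l, jmh (Z l ω) =
        ∏ l, (fun (l : Fin N) z => (if l = i then u z else 1) * jmh z) l (Z l ω) := by
      intro ω
      simp only [Finset.prod_mul_distrib, Finset.prod_ite_eq', Finset.mem_univ, if_true]
    simp_rw [e1]
    rw [jm_prod hZ hind (fun (l : Fin N) z => (if l = i then u z else 1) * jmh z),
      ← Finset.mul_prod_erase _ _ (Finset.mem_univ i)]
    have e2 : ∫ ω, (if i = i then u (Z i ω) else 1) * jmh (Z i ω) ∂P ≤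
        Real.exp 2 * ∫ ω, u (Z j ω) ∂P := by
      simp only [if_true]
      rw [← integral_const_mul, jm_same hZ hid i j (fun z => u z * jmh z)]
      refine integral_mono (jm_int1 hZ j (fun z => u z * jmh z))
        (jm_int1 hZ j (fun z => Real.exp 2 * u z)) (fun ω => ?_)
      show u (Z j ω) * jmh (Z j ω) ≤ _
      rw [mul_comm]
      exact mul_le_mul_of_nonneg_right (jmh_le _) (hu _)
    have e3 : ∏ l ∈ Finset.univ.erase i,
        ∫ ω, (if l = i then u (Z l ω) else 1) * jmh (Z l ω) ∂P ≤
        Real.exp (2 * Real.exp 2 * C₀) := by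
      calc _ ≤ ∏ l ∈ Finset.univ.erase i, Real.exp (2 * Real.exp 2 * C₀ / N) := by
            refine Finset.prod_le_prod (fun l hl => ?_) (fun l hl => ?_)
            · refine integral_nonneg (fun ω => mul_nonneg ?_ (Real.exp_pos _).le)
              split_ifs
              · exact hu _
              · norm_num
            · simp only [Finset.ne_of_mem_erase hl, if_false, one_mul]
              exact hh l
        _ = Real.exp (2 * Real.exp 2 * C₀ / N) ^ (Finset.univ.erase i).card := by simp
        _ ≤ Real.exp (2 * Real.exp 2 * C₀ / N) ^ N := by
            refine pow_le_pow_right₀ (Real.one_le_exp (by positivity)) ?_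
            simp
        _ = _ := by
            rw [← Real.exp_nat_mul]
            congr 1
            field_simp
    have hun : 0 ≤ ∫ ω, u (Z j ω) ∂P := integral_nonneg (fun ω => hu _)
    refine (mul_le_mul e2 e3 (Finset.prod_nonneg fun l hl => integral_nonneg fun ω => ?_)
      (by positivity)).trans (le_of_eq (by ring))
    refine mul_nonneg ?_ (Real.exp_pos _).le
    split_ifs
    · exact hu _
    · norm_num
  calc _ ≤ ∫ ω, (a.factorial * b.factorial : ℝ) * (u (Z i ω) * ∏ l, jmh (Z l ω)) ∂P := by
        refine integral_mono
          (jm_int hZ (fun z => u (z i) * ((∑ l, jmx (z l)) ^ a * (∑ l, jmy (z l)) ^ b)))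
          (jm_int hZ (fun z => (a.factorial * b.factorial : ℝ) * (u (z i) * ∏ l, jmh (z l))))
          (fun ω => ?_)
        have hS : 0 ≤ ∑ l, jmx (Z l ω) := Finset.sum_nonneg fun l _ => jmx_nonneg _
        have hT : 0 ≤ ∑ l, jmy (Z l ω) := Finset.sum_nonneg fun l _ => jmy_nonneg _
        have e : ∏ l, jmh (Z l ω) =
            Real.exp (∑ l, jmx (Z l ω)) * Real.exp (∑ l, jmy (Z l ω)) := by
          unfold jmh
          rw [← Real.exp_sum, Finset.sum_add_distrib, Real.exp_add]
        show u (Z i ω) * _ ≤ (a.factorial * b.factorial : ℝ) * (u (Z i ω) * ∏ l, jmh (Z l ω))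
        rw [e]
        have := mul_le_mul_of_nonneg_left
          (mul_le_mul (key _ a hS) (key _ b hT) (by positivity) (by positivity)) (hu (Z i ω))
        refine this.trans (le_of_eq (by ring))
    _ ≤ _ := by
        rw [integral_const_mul]
        refine (mul_le_mul_of_nonneg_left hprod (by positivity)).trans (le_of_eq (by ring))

lemma jm_fib (n : ℕ) (f : Fin n → Fin N) (v : Fin N → ℝ) :
    ∏ l, v (f l) = ∏ j, v j ^ (Finset.univ.filter (fun l => f l = j)).card := by
  rw [← Finset.prod_fiberwise' Finset.univ f v]
  simp

lemma jm_term (hZ : ∀ j, Measurable (Z j)) (hind : iIndepFun Z P) (k k' : ℕ)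
    (f : Fin k → Fin N) (g : Fin k' → Fin N) :
    |(∫ ω, (∏ l, jmx (Z (f l) ω)) * ∏ l, jmy (Z (g l) ω) ∂P)
      - (∫ ω, ∏ l, jmx (Z (f l) ω) ∂P) * ∫ ω, ∏ l, jmy (Z (g l) ω) ∂P| ≤
    ∑ j, ((∫ ω, jmx (Z j ω) * jmy (Z j ω) *
        ((∏ l, jmx (Z (f l) ω)) * ∏ l, jmy (Z (g l) ω)) ∂P)
      + (∫ ω, jmx (Z j ω) * ∏ l, jmx (Z (f l) ω) ∂P) *
        ∫ ω, jmy (Z j ω) * ∏ l, jmy (Z (g l) ω) ∂P) := by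
  have nx : ∀ ω, 0 ≤ ∏ l, jmx (Z (f l) ω) := fun ω => Finset.prod_nonneg fun l _ => jmx_nonneg _
  have ny : ∀ ω, 0 ≤ ∏ l, jmy (Z (g l) ω) := fun ω => Finset.prod_nonneg fun l _ => jmy_nonneg _
  have n1 : ∀ j, 0 ≤ ∫ ω, jmx (Z j ω) * jmy (Z j ω) *
        ((∏ l, jmx (Z (f l) ω)) * ∏ l, jmy (Z (g l) ω)) ∂P := fun j => integral_nonneg fun ω =>
    mul_nonneg (mul_nonneg (jmx_nonneg _) (jmy_nonneg _)) (mul_nonneg (nx ω) (ny ω))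
  have n2 : ∀ j, 0 ≤ ∫ ω, jmx (Z j ω) * ∏ l, jmx (Z (f l) ω) ∂P := fun j =>
    integral_nonneg fun ω => mul_nonneg (jmx_nonneg _) (nx ω)
  have n3 : ∀ j, 0 ≤ ∫ ω, jmy (Z j ω) * ∏ l, jmy (Z (g l) ω) ∂P := fun j =>
    integral_nonneg fun ω => mul_nonneg (jmy_nonneg _) (ny ω)
  have hnn : ∀ j ∈ Finset.univ, 0 ≤ (∫ ω, jmx (Z j ω) * jmy (Z j ω) *
        ((∏ l, jmx (Z (f l) ω)) * ∏ l, jmy (Z (g l) ω)) ∂P)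
      + (∫ ω, jmx (Z j ω) * ∏ l, jmx (Z (f l) ω) ∂P) *
        ∫ ω, jmy (Z j ω) * ∏ l, jmy (Z (g l) ω) ∂P := fun j _ =>
    add_nonneg (n1 j) (mul_nonneg (n2 j) (n3 j))
  by_cases hd : ∃ a b, f a = g b
  · obtain ⟨a, b, hab⟩ := hd
    refine le_trans ?_ (Finset.single_le_sum hnn (Finset.mem_univ (f a)))
    have ex : ∀ ω, jmx (Z (f a) ω) * ∏ l, jmx (Z (f l) ω) = ∏ l, jmx (Z (f l) ω) := by
      intro ω
      rw [← Finset.mul_prod_erase _ _ (Finset.mem_univ a), ← mul_assoc, jmx_idem]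
    have ey : ∀ ω, jmy (Z (f a) ω) * ∏ l, jmy (Z (g l) ω) = ∏ l, jmy (Z (g l) ω) := by
      intro ω
      rw [hab, ← Finset.mul_prod_erase _ _ (Finset.mem_univ b), ← mul_assoc, jmy_idem]
    have exy : ∀ ω, jmx (Z (f a) ω) * jmy (Z (f a) ω) *
        ((∏ l, jmx (Z (f l) ω)) * ∏ l, jmy (Z (g l) ω)) =
        (∏ l, jmx (Z (f l) ω)) * ∏ l, jmy (Z (g l) ω) := by
      intro ω
      rw [mul_mul_mul_comm, ex, ey]
    simp_rw [exy, ex, ey]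
    have m1 : 0 ≤ ∫ ω, (∏ l, jmx (Z (f l) ω)) * ∏ l, jmy (Z (g l) ω) ∂P :=
      integral_nonneg fun ω => mul_nonneg (nx ω) (ny ω)
    have m2 : 0 ≤ (∫ ω, ∏ l, jmx (Z (f l) ω) ∂P) * ∫ ω, ∏ l, jmy (Z (g l) ω) ∂P :=
      mul_nonneg (integral_nonneg nx) (integral_nonneg ny)
    rw [abs_le]
    constructor <;> linarith
  · push Not at hd
    refine le_trans (le_of_eq ?_) (Finset.sum_nonneg hnn)
    rw [abs_eq_zero, sub_eq_zero]
    have e1 : ∀ ω, ∏ l, jmx (Z (f l) ω) = _ := fun ω => jm_fib k f (fun j => jmx (Z j ω))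
    have e2 : ∀ ω, ∏ l, jmy (Z (g l) ω) = _ := fun ω => jm_fib k' g (fun j => jmy (Z j ω))
    simp_rw [e1, e2, ← Finset.prod_mul_distrib]
    set n : Fin N → ℕ := fun j => (Finset.univ.filter (fun l => f l = j)).card with hn
    set m : Fin N → ℕ := fun j => (Finset.univ.filter (fun l => g l = j)).card with hm
    have h1 := jm_prod hZ hind (fun j z => jmx z ^ n j * jmy z ^ m j)
    have h2 := jm_prod hZ hind (fun j z => jmx z ^ n j)
    have h3 := jm_prod hZ hind (fun j z => jmy z ^ m j)
    refine h1.trans (Eq.trans ?_ (congrArg₂ (· * ·) h2 h3).symm)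
    show _ = (∏ i, _) * (∏ i, _)
    rw [← Finset.prod_mul_distrib]
    refine Finset.prod_congr rfl fun j _ => ?_
    have : n j = 0 ∨ m j = 0 := by
      by_contra hcon
      push Not at hcon
      obtain ⟨a, ha⟩ := Finset.card_ne_zero.1 hcon.1
      obtain ⟨b, hb⟩ := Finset.card_ne_zero.1 hcon.2
      simp only [Finset.mem_filter, Finset.mem_univ, true_and] at ha hb
      exact hd a b (ha.trans hb.symm)
    rcases this with h | h <;> simp [h]

lemma jm_cov (hZ : ∀ j, Measurable (Z j)) (hind : iIndepFun Z P) (k k' : ℕ) :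
    |(∫ ω, (∑ j, jmx (Z j ω)) ^ k * (∑ j, jmy (Z j ω)) ^ k' ∂P)
      - (∫ ω, (∑ j, jmx (Z j ω)) ^ k ∂P) * ∫ ω, (∑ j, jmy (Z j ω)) ^ k' ∂P| ≤
    ∑ j, ((∫ ω, jmx (Z j ω) * jmy (Z j ω) *
        ((∑ j, jmx (Z j ω)) ^ k * (∑ j, jmy (Z j ω)) ^ k') ∂P)
      + (∫ ω, jmx (Z j ω) * (∑ j, jmx (Z j ω)) ^ k ∂P) *
        ∫ ω, jmy (Z j ω) * (∑ j, jmy (Z j ω)) ^ k' ∂P) := by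
  have eS : ∀ ω, (∑ j, jmx (Z j ω)) ^ k = ∑ f : Fin k → Fin N, ∏ l, jmx (Z (f l) ω) :=
    fun ω => Fintype.sum_pow _ _
  have eT : ∀ ω, (∑ j, jmy (Z j ω)) ^ k' = ∑ g : Fin k' → Fin N, ∏ l, jmy (Z (g l) ω) :=
    fun ω => Fintype.sum_pow _ _
  have i1 : ∫ ω, (∑ j, jmx (Z j ω)) ^ k ∂P =
      ∑ f : Fin k → Fin N, ∫ ω, ∏ l, jmx (Z (f l) ω) ∂P := by
    simp_rw [eS]
    exact integral_finsetSum _ fun f _ => jm_int hZ (fun z => ∏ l, jmx (z (f l)))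
  have i2 : ∫ ω, (∑ j, jmy (Z j ω)) ^ k' ∂P =
      ∑ g : Fin k' → Fin N, ∫ ω, ∏ l, jmy (Z (g l) ω) ∂P := by
    simp_rw [eT]
    exact integral_finsetSum _ fun f _ => jm_int hZ (fun z => ∏ l, jmy (z (f l)))
  have i3 : ∀ j, ∫ ω, jmx (Z j ω) * (∑ j, jmx (Z j ω)) ^ k ∂P =
      ∑ f : Fin k → Fin N, ∫ ω, jmx (Z j ω) * ∏ l, jmx (Z (f l) ω) ∂P := by
    intro j
    simp_rw [eS, Finset.mul_sum]
    exact integral_finsetSum _ fun f _ => jm_int hZ (fun z => jmx (z j) * ∏ l, jmx (z (f l)))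
  have i4 : ∀ j, ∫ ω, jmy (Z j ω) * (∑ j, jmy (Z j ω)) ^ k' ∂P =
      ∑ f : Fin k' → Fin N, ∫ ω, jmy (Z j ω) * ∏ l, jmy (Z (f l) ω) ∂P := by
    intro j
    simp_rw [eT, Finset.mul_sum]
    exact integral_finsetSum _ fun f _ => jm_int hZ (fun z => jmy (z j) * ∏ l, jmy (z (f l)))
  have i5 : ∫ ω, (∑ j, jmx (Z j ω)) ^ k * (∑ j, jmy (Z j ω)) ^ k' ∂P =
      ∑ f : Fin k → Fin N, ∑ g : Fin k' → Fin N,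
        ∫ ω, (∏ l, jmx (Z (f l) ω)) * ∏ l, jmy (Z (g l) ω) ∂P := by
    simp_rw [eS, eT, Finset.sum_mul_sum]
    rw [integral_finsetSum _ fun f _ => jm_int hZ
      (fun z => ∑ g : Fin k' → Fin N, (∏ l, jmx (z (f l))) * ∏ l, jmy (z (g l)))]
    refine Finset.sum_congr rfl fun f _ => ?_
    exact integral_finsetSum _ fun g _ => jm_int hZ
      (fun z => (∏ l, jmx (z (f l))) * ∏ l, jmy (z (g l)))
  have i6 : ∀ j, ∫ ω, jmx (Z j ω) * jmy (Z j ω) *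
        ((∑ j, jmx (Z j ω)) ^ k * (∑ j, jmy (Z j ω)) ^ k') ∂P =
      ∑ f : Fin k → Fin N, ∑ g : Fin k' → Fin N,
        ∫ ω, jmx (Z j ω) * jmy (Z j ω) *
          ((∏ l, jmx (Z (f l) ω)) * ∏ l, jmy (Z (g l) ω)) ∂P := by
    intro j
    simp_rw [eS, eT, Finset.sum_mul_sum, Finset.mul_sum]
    rw [integral_finsetSum _ fun f _ => jm_int hZ
      (fun z => ∑ g : Fin k' → Fin N, jmx (z j) * jmy (z j) *
        ((∏ l, jmx (z (f l))) * ∏ l, jmy (z (g l))))]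
    refine Finset.sum_congr rfl fun f _ => ?_
    exact integral_finsetSum _ fun g _ => jm_int hZ
      (fun z => jmx (z j) * jmy (z j) * ((∏ l, jmx (z (f l))) * ∏ l, jmy (z (g l))))
  rw [i5, i1, i2]
  simp_rw [i6, i3, i4, Finset.sum_mul_sum, ← Finset.sum_add_distrib, ← Finset.sum_sub_distrib]
  refine (Finset.abs_sum_le_sum_abs _ _).trans ?_
  rw [Finset.sum_comm]
  refine Finset.sum_le_sum fun f _ => (Finset.abs_sum_le_sum_abs _ _).trans ?_
  rw [Finset.sum_comm]
  exact Finset.sum_le_sum fun g _ => jm_term hZ hind k k' f g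
end

/-- Asymptotic independence estimate: for `N` i.i.d. pairs of Bernoulli random variables with
success probabilities at most `C₀/N`, the joint moments of the two counts `S` and `T`
factorize up to an error controlled by `N·E[X₁]E[Y₁] + N·E[X₁Y₁]`. -/
theorem joint_moment_factorization (k k' : ℕ) (C₀ : ℝ) (hC₀ : 0 < C₀) :
    ∃ C : ℝ, ∀ (N : ℕ) (hN : 1 ≤ N),
      ∀ (Ω : Type) [MeasurableSpace Ω] (P : Measure Ω), IsProbabilityMeasure P →
      ∀ (Z : Fin N → Ω → Bool × Bool), (∀ j, Measurable (Z j)) →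
      iIndepFun Z P →
      (∀ j j' : Fin N, Measure.map (Z j) P = Measure.map (Z j') P) →
      (P {ω | (Z ⟨0, hN⟩ ω).1 = true}).toReal ≤ C₀ / N →
      (P {ω | (Z ⟨0, hN⟩ ω).2 = true}).toReal ≤ C₀ / N →
      |(∫ ω, (∑ j, if (Z j ω).1 then (1 : ℝ) else 0) ^ k *
            (∑ j, if (Z j ω).2 then (1 : ℝ) else 0) ^ k' ∂P)
        - (∫ ω, (∑ j, if (Z j ω).1 then (1 : ℝ) else 0) ^ k ∂P) *
          (∫ ω, (∑ j, if (Z j ω).2 then (1 : ℝ) else 0) ^ k' ∂P)|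
      ≤ C * ((N : ℝ) * (∫ ω, (if (Z ⟨0, hN⟩ ω).1 then (1 : ℝ) else 0) ∂P) *
              (∫ ω, (if (Z ⟨0, hN⟩ ω).2 then (1 : ℝ) else 0) ∂P)
            + (N : ℝ) * ∫ ω, (if (Z ⟨0, hN⟩ ω).1 then (1 : ℝ) else 0) *
              (if (Z ⟨0, hN⟩ ω).2 then (1 : ℝ) else 0) ∂P) := by
  refine ⟨(k.factorial * k'.factorial * Real.exp 2 * Real.exp (2 * Real.exp 2 * C₀)) +
    (k.factorial * Real.exp 2 * Real.exp (2 * Real.exp 2 * C₀)) *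
    (k'.factorial * Real.exp 2 * Real.exp (2 * Real.exp 2 * C₀)), ?_⟩
  intro N hN Ω _ P hP Z hZ hind hid hx hy
  have hx' : ∫ ω, jmx (Z ⟨0, hN⟩ ω) ∂P ≤ C₀ / N := by
    have : (fun ω => jmx (Z ⟨0, hN⟩ ω)) = Set.indicator {ω | (Z ⟨0, hN⟩ ω).1 = true} 1 := by
      ext ω; simp [jmx, Set.indicator]
    rw [this, integral_indicator_one (measurableSet_eq_fun (by fun_prop) (by fun_prop))]
    exact hx
  have hy' : ∫ ω, jmy (Z ⟨0, hN⟩ ω) ∂P ≤ C₀ / N := by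
    have : (fun ω => jmy (Z ⟨0, hN⟩ ω)) = Set.indicator {ω | (Z ⟨0, hN⟩ ω).2 = true} 1 := by
      ext ω; simp [jmy, Set.indicator]
    rw [this, integral_indicator_one (measurableSet_eq_fun (by fun_prop) (by fun_prop))]
    exact hy
  refine (jm_cov hZ hind k k').trans ?_
  show _ ≤ _ * ((N : ℝ) * (∫ ω, jmx (Z ⟨0, hN⟩ ω) ∂P) * (∫ ω, jmy (Z ⟨0, hN⟩ ω) ∂P)
    + (N : ℝ) * ∫ ω, jmx (Z ⟨0, hN⟩ ω) * jmy (Z ⟨0, hN⟩ ω) ∂P)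
  have hp : 0 ≤ ∫ ω, jmx (Z ⟨0, hN⟩ ω) ∂P := integral_nonneg fun ω => jmx_nonneg _
  have hq : 0 ≤ ∫ ω, jmy (Z ⟨0, hN⟩ ω) ∂P := integral_nonneg fun ω => jmy_nonneg _
  have hr : 0 ≤ ∫ ω, jmx (Z ⟨0, hN⟩ ω) * jmy (Z ⟨0, hN⟩ ω) ∂P :=
    integral_nonneg fun ω => mul_nonneg (jmx_nonneg _) (jmy_nonneg _)
  have hb : ∀ j ∈ (Finset.univ : Finset (Fin N)), _ ≤ _ := fun j _ => add_le_add
    (jm_mom hZ hind hid C₀ hC₀ ⟨0, hN⟩ hx' hy' (fun z => jmx z * jmy z)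
      (fun z => mul_nonneg (jmx_nonneg _) (jmy_nonneg _)) k k' j)
    (mul_le_mul (jm_mom hZ hind hid C₀ hC₀ ⟨0, hN⟩ hx' hy' jmx jmx_nonneg k 0 j)
      (jm_mom hZ hind hid C₀ hC₀ ⟨0, hN⟩ hx' hy' jmy jmy_nonneg 0 k' j)
      (integral_nonneg fun ω => mul_nonneg (jmy_nonneg _) (mul_nonneg
        (pow_nonneg (Finset.sum_nonneg fun l _ => jmx_nonneg _) _)
        (pow_nonneg (Finset.sum_nonneg fun l _ => jmy_nonneg _) _))) (by positivity))
  have hs := Finset.sum_le_sum hb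
  simp only [pow_zero, one_mul, mul_one, Nat.factorial_zero, Nat.cast_one, Finset.sum_const,
    Finset.card_univ, Fintype.card_fin, nsmul_eq_mul] at hs
  refine hs.trans ?_
  generalize (∫ ω, jmx (Z ⟨0, hN⟩ ω) * jmy (Z ⟨0, hN⟩ ω) ∂P) = r at *
  generalize (∫ ω, jmx (Z ⟨0, hN⟩ ω) ∂P) = p at *
  generalize (∫ ω, jmy (Z ⟨0, hN⟩ ω) ∂P) = q at *
  have hA : 0 ≤ (k.factorial * k'.factorial * Real.exp 2 * Real.exp (2 * Real.exp 2 * C₀) : ℝ) := by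
    positivity
  have hB : 0 ≤ ((k.factorial * Real.exp 2 * Real.exp (2 * Real.exp 2 * C₀)) *
    (k'.factorial * Real.exp 2 * Real.exp (2 * Real.exp 2 * C₀)) : ℝ) := by positivity
  have h1 : 0 ≤ (N : ℝ) * p * q := by positivity
  have h2 : 0 ≤ (N : ℝ) * r := by positivity
  have h3 := mul_nonneg hA h1
  have h4 := mul_nonneg hB h2
  linarith
end

section
/- Let d ≥ 1, let R ≥ 0 be an integer, let Γ be a finite subset of ℤ^d, and let (X_γ)_{γ ∈ Γ} be real random variables with 0 ≤ X_γ ≤ 1 almost surely, such that X_γ and X_{γ'} are independent whenever the sup-norm distance |γ − γ'|_∞ exceeds R. Then Var(Σ_{γ ∈ Γ} X_γ) ≤ (2R+1)^d · Σ_{γ ∈ Γ} E[X_γ]. -/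
open MeasureTheory ProbabilityTheory

/-- Variance bound for sums of `[0,1]`-valued random variables indexed by lattice points with
finite range of dependence `R` (in sup-norm): the variance of the sum is at most
`(2R+1)^d` times the sum of the expectations. -/
theorem variance_bound_finite_range (d : ℕ) (hd : 1 ≤ d) (R : ℕ)
    {Ω : Type*} [MeasurableSpace Ω] (P : Measure Ω) [IsProbabilityMeasure P]
    (Γ : Finset (Fin d → ℤ)) (X : (Fin d → ℤ) → Ω → ℝ)
    (hmeas : ∀ γ, Measurable (X γ))
    (hbound : ∀ γ, ∀ᵐ ω ∂P, X γ ω ∈ Set.Icc (0 : ℝ) 1)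
    (hindep : ∀ γ ∈ Γ, ∀ γ' ∈ Γ, (∃ i, (R : ℤ) < |γ i - γ' i|) →
      IndepFun (X γ) (X γ') P) :
    variance (fun ω => ∑ γ ∈ Γ, X γ ω) P
      ≤ ((2 * R + 1 : ℝ)) ^ d * ∑ γ ∈ Γ, ∫ ω, X γ ω ∂P := by
  classical
  have hL : ∀ γ, MemLp (X γ) 2 P := fun γ =>
    MemLp.of_bound (hmeas γ).aestronglyMeasurable 1 (by
      filter_upwards [hbound γ] with ω h
      rw [Real.norm_eq_abs, abs_of_nonneg h.1]
      exact h.2)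
  have hI : ∀ γ, Integrable (X γ) P := fun γ => (hL γ).integrable (by norm_num)
  have hE : ∀ γ, 0 ≤ ∫ ω, X γ ω ∂P := fun γ =>
    integral_nonneg_of_ae (by filter_upwards [hbound γ] with ω h using h.1)
  have hcov : ∀ γ γ', covariance (X γ) (X γ') P ≤ ∫ ω, X γ ω ∂P := by
    intro γ γ'
    rw [covariance_eq_sub (hL γ) (hL γ')]
    have h1 : ∫ ω, (X γ * X γ') ω ∂P ≤ ∫ ω, X γ ω ∂P := by
      refine integral_mono_ae ((hL γ).integrable_mul (hL γ')) (hI γ) ?_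
      filter_upwards [hbound γ, hbound γ'] with ω h h'
      exact mul_le_of_le_one_right h.1 h'.2
    have h2 := mul_nonneg (hE γ) (hE γ')
    linarith
  rw [variance_fun_sum' (fun γ _ => hL γ), Finset.mul_sum]
  refine Finset.sum_le_sum fun γ hγ => ?_
  let B : Finset (Fin d → ℤ) := Fintype.piFinset fun i => Finset.Icc (γ i - R) (γ i + R)
  have hB : (B.card : ℝ) = (2 * R + 1 : ℝ) ^ d := by
    have h : B.card = (2 * R + 1) ^ d := by
      simp only [B, Fintype.card_piFinset, Int.card_Icc]
      rw [Finset.prod_congr rfl (g := fun _ => 2 * R + 1) (fun i _ => by omega)]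
      simp
    rw [h]; push_cast; rfl
  calc ∑ γ' ∈ Γ, covariance (X γ) (X γ') P
      ≤ ∑ γ' ∈ Γ, if γ' ∈ B then ∫ ω, X γ ω ∂P else 0 := by
        refine Finset.sum_le_sum fun γ' hγ' => ?_
        split_ifs with h
        · exact hcov γ γ'
        · refine (IndepFun.covariance_eq_zero (hindep γ hγ γ' hγ' ?_) (hL γ) (hL γ')).le
          by_contra! hc
          refine h (Fintype.mem_piFinset.2 fun i => Finset.mem_Icc.2 ?_)
          have := abs_le.1 (hc i)
          constructor <;> linarith
    _ = ((Γ.filter (· ∈ B)).card : ℝ) * ∫ ω, X γ ω ∂P := by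
        rw [← Finset.sum_filter, Finset.sum_const, nsmul_eq_mul]
    _ ≤ (2 * R + 1 : ℝ) ^ d * ∫ ω, X γ ω ∂P := by
        rw [← hB]
        refine mul_le_mul_of_nonneg_right ?_ (hE γ)
        exact_mod_cast Finset.card_le_card fun x hx => (Finset.mem_filter.1 hx).2
end
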